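/- (Upper Bound Theorem for almost simplicial polytopes, f-vector form.) Let d ≥ 2, s ≥ 0, n > d+s, and let P ∈ P(d,n,s). Then for every 1 ≤ i ≤ d, f_{i−1}(P) ≤ f_{i−1}(C(d,n,s)), where C(d,n,s) is the almost cyclic polytope. -/

import Mathlib

open Finset

namespace ASP

noncomputable section

/-- The dot product of two vectors in `ℝ^d`. -/
def dotp {d : ℕ} (x y : Fin d → ℝ) : ℝ := ∑ i, x i * y i

/-- `F` is a face of the polytope `P ⊆ ℝ^d`: the intersection of `P` with a supporting
hyperplane, together with the empty face and `P` itself. -/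
def IsFaceOf {d : ℕ} (P F : Set (Fin d → ℝ)) : Prop :=
  F = ∅ ∨ F = P ∨
    ∃ (b : Fin d → ℝ) (c : ℝ), b ≠ 0 ∧ (∀ x ∈ P, dotp b x ≤ c) ∧
      F = {x ∈ P | dotp b x = c}

/-- The dimension of a subset of `ℝ^d`: the dimension of its affine span. -/
def polyDim {d : ℕ} (S : Set (Fin d → ℝ)) : ℕ :=
  Module.finrank ℝ (affineSpan ℝ S).direction

/-- A polytope: the convex hull of a finite point set. -/
def IsPolytope {d : ℕ} (P : Set (Fin d → ℝ)) : Prop :=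
  ∃ V : Finset (Fin d → ℝ), P = convexHull ℝ (V : Set (Fin d → ℝ))

/-- The vertex set of a polytope: its set of extreme points. -/
def verts {d : ℕ} (P : Set (Fin d → ℝ)) : Set (Fin d → ℝ) :=
  Set.extremePoints ℝ P

/-- `fVec P i` is the number of `i`-dimensional (nonempty) faces of `P`. -/
def fVec {d : ℕ} (P : Set (Fin d → ℝ)) (i : ℕ) : ℕ :=
  {F : Set (Fin d → ℝ) | IsFaceOf P F ∧ F.Nonempty ∧ polyDim F = i}.ncard

/-- A facet of a `d`-polytope in `ℝ^d`: a `(d-1)`-dimensional face. -/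
def IsFacetOf {d : ℕ} (P F : Set (Fin d → ℝ)) : Prop :=
  IsFaceOf P F ∧ F.Nonempty ∧ polyDim F = d - 1

/-- `(P, F)` is an ASP-pair: `P` is a `d`-polytope, `F` is a facet of `P`, and every facet
of `P` other than `F` is a simplex (i.e. has exactly `d` vertices). -/
def IsASPPair {d : ℕ} (P F : Set (Fin d → ℝ)) : Prop :=
  IsPolytope P ∧ polyDim P = d ∧ IsFacetOf P F ∧
    ∀ G, IsFacetOf P G → G ≠ F → (verts G).ncard = d

/-- `P ∈ 𝒫(d,n,s)`: `P` is a `d`-polytope with `n` vertices such that `(P,F)` is an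
ASP-pair where the facet `F` has `d + s` vertices. -/
def MemASP (d n s : ℕ) (P : Set (Fin d → ℝ)) : Prop :=
  (verts P).ncard = n ∧ ∃ F, IsASPPair P F ∧ (verts F).ncard = d + s

/-- `fBall P i` is `f_{i-1}(P')` of the simplicial ball `P' = ∂P - {F}` consisting of all
proper faces of `P` except its (unique non-simplex) facet `F`; the index is shifted by one,
so `fBall P 0 = f_{-1} = 1` counts the empty face, and at the top dimension the facet `F`
is discarded. -/
def fBall {d : ℕ} (P : Set (Fin d → ℝ)) (i : ℕ) : ℤ :=
  if i = 0 then 1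
  else if i = d then (fVec P (d - 1) : ℤ) - 1
  else if d < i then 0
  else (fVec P (i - 1) : ℤ)

/-- `hBall P k` is `h_k(P')` of the `(d-1)`-dimensional ball `P' = ∂P - {F}`, defined by
`h_k = ∑_{i=0}^{k} (-1)^{k-i} C(d-i, k-i) f_{i-1}(P')`, extended by `0` outside `0 ≤ k ≤ d`. -/
def hBall {d : ℕ} (P : Set (Fin d → ℝ)) (k : ℤ) : ℤ :=
  if 0 ≤ k ∧ k ≤ (d : ℤ) then
    ∑ i ∈ Finset.range (k.toNat + 1),
      (-1) ^ (k.toNat - i) * ((d - i).choose (k.toNat - i) : ℤ) * fBall P i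
  else 0

/-- `fBd m Q i` is `f_{i-1}(∂Q)` of the boundary complex of an `m`-polytope `Q ⊆ ℝ^d`
(a complex of dimension `m - 1`); the index is shifted by one. -/
def fBd {d : ℕ} (m : ℕ) (Q : Set (Fin d → ℝ)) (i : ℕ) : ℤ :=
  if i = 0 then 1 else if m + 1 ≤ i then 0 else (fVec Q (i - 1) : ℤ)

/-- `hBd m Q k` is `h_k(∂Q)` for the boundary complex of an `m`-polytope `Q ⊆ ℝ^d`, defined by
`h_k = ∑_{i=0}^{k} (-1)^{k-i} C(m-i, k-i) f_{i-1}(∂Q)`, extended by `0` outside `0 ≤ k ≤ m`. -/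
def hBd {d : ℕ} (m : ℕ) (Q : Set (Fin d → ℝ)) (k : ℤ) : ℤ :=
  if 0 ≤ k ∧ k ≤ (m : ℤ) then
    ∑ i ∈ Finset.range (k.toNat + 1),
      (-1) ^ (k.toNat - i) * ((m - i).choose (k.toNat - i) : ℤ) * fBd m Q i
  else 0

/-- `gBd m Q k = g_k(∂Q) = h_k(∂Q) - h_{k-1}(∂Q)`. -/
def gBd {d : ℕ} (m : ℕ) (Q : Set (Fin d → ℝ)) (k : ℤ) : ℤ :=
  hBd m Q k - hBd m Q (k - 1)

/-- The function `p(t) = (n-1)^{(t-1)(d-1)} · t(t+1)⋯(t+d+s-1)` (real exponentiation of the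
positive base `n-1`) used to define the almost cyclic polytope. -/
def acp (d n s : ℕ) (t : ℝ) : ℝ :=
  ((n : ℝ) - 1) ^ ((t - 1) * ((d : ℝ) - 1)) * ∏ l ∈ Finset.range (d + s), (t + l)

/-- The curve `y(t) = (t, t², …, t^{d-1}, p(t)) ∈ ℝ^d`. -/
def acy (d n s : ℕ) (t : ℝ) : Fin d → ℝ :=
  fun i => if (i : ℕ) + 1 = d then acp d n s t else t ^ ((i : ℕ) + 1)

/-- The parameter values `t_i = -s - d + i` for `i = 1, …, n` (here `0`-indexed:
`acT d s j = t_{j+1}`). -/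
def acT (d s j : ℕ) : ℝ := (j : ℝ) + 1 - s - d

/-- The `n` points `y(t_1), …, y(t_n)` on the curve `y` (`0`-indexed). -/
def acPoint (d n s : ℕ) (j : Fin n) : Fin d → ℝ := acy d n s (acT d s (j : ℕ))

/-- The almost cyclic polytope `C(d,n,s) = conv{y(t_1), …, y(t_n)}`. -/
def acPolytope (d n s : ℕ) : Set (Fin d → ℝ) :=
  convexHull ℝ (Set.range (acPoint d n s))

/-- The non-simplex facet `F = conv{y(t_1), …, y(t_{d+s})}` of the almost cyclic polytope. -/
def acFacet (d n s : ℕ) : Set (Fin d → ℝ) :=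
  convexHull ℝ (acPoint d n s '' {j : Fin n | (j : ℕ) < d + s})

/-- The generalized moment curve
`x(t) = (t, t², …, t^{d-r}, p_1(t), …, p_r(t)) ∈ ℝ^d`. -/
def gmc (d r : ℕ) (p : Fin r → ℝ → ℝ) (t : ℝ) : Fin d → ℝ :=
  fun i =>
    if h : (i : ℕ) < d - r then t ^ ((i : ℕ) + 1)
    else p ⟨(i : ℕ) - (d - r), by have h2 := i.2; omega⟩ t

/-- A polytope is `k`-neighborly if each subset of at most `k` of its vertices is the
vertex set of a face. -/
def IsNeighborly {d : ℕ} (k : ℕ) (P : Set (Fin d → ℝ)) : Prop :=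
  ∀ S : Finset (Fin d → ℝ), (S : Set (Fin d → ℝ)) ⊆ verts P → S.card ≤ k →
    ∃ G : Set (Fin d → ℝ), IsFaceOf P G ∧ verts G = (S : Set (Fin d → ℝ))

/-- The point `y` is beyond the facet `F` of the polytope `P`: for every supporting
hyperplane of `P` cutting out a facet, `y` is strictly on the outer side if the facet is `F`,
and strictly on the inner side otherwise. -/
def IsBeyond {d : ℕ} (P F : Set (Fin d → ℝ)) (y : Fin d → ℝ) : Prop :=
  ∀ (b : Fin d → ℝ) (c : ℝ), b ≠ 0 → (∀ x ∈ P, dotp b x ≤ c) →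
    IsFacetOf P {x ∈ P | dotp b x = c} →
      (({x ∈ P | dotp b x = c} = F → c < dotp b y) ∧
       ({x ∈ P | dotp b x = c} ≠ F → dotp b y < c))



/-! ### Part A: the dual polyhedron and the partition of the face complex -/

open Classical in
/-- `tightS W y` : elements of `W` on which `y` equals one. -/
def tightS {d : ℕ} (W : Finset (Fin d → ℝ)) (y : Fin d → ℝ) : Finset (Fin d → ℝ) :=
  W.filter (fun w => y ⬝ᵥ w = 1)

def Pol {d : ℕ} (W : Finset (Fin d → ℝ)) (y : Fin d → ℝ) : Prop := ∀ w ∈ W, y ⬝ᵥ w ≤ 1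

def IsF {d : ℕ} (W : Finset (Fin d → ℝ)) (S : Finset (Fin d → ℝ)) : Prop :=
  ∃ y, Pol W y ∧ tightS W y = S

def LI {d : ℕ} (S : Finset (Fin d → ℝ)) : Prop := LinearIndepOn ℝ id (S : Set (Fin d → ℝ))

lemma mem_tightS {d : ℕ} {W : Finset (Fin d → ℝ)} {y w : Fin d → ℝ} :
    w ∈ tightS W y ↔ w ∈ W ∧ y ⬝ᵥ w = 1 := by simp [tightS]

lemma exists_vec {d : ℕ} (f : (Fin d → ℝ) →ₗ[ℝ] ℝ) : ∃ e : Fin d → ℝ, ∀ x, f x = e ⬝ᵥ x := by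
  refine ⟨(dotProductEquiv ℝ (Fin d)).symm f, fun x => ?_⟩
  have := (dotProductEquiv ℝ (Fin d)).apply_symm_apply f
  conv_lhs => rw [← this]
  rfl

lemma LI.exists_dual {d : ℕ} {S : Finset (Fin d → ℝ)} (h : LI S) (c : (Fin d → ℝ) → ℝ) :
    ∃ e : Fin d → ℝ, ∀ s ∈ S, e ⬝ᵥ s = c s := by
  have h' : LinearIndepOn ℝ id (S : Set (Fin d → ℝ)) := h
  let B := Module.Basis.extend h'
  obtain ⟨e, he⟩ := exists_vec (B.constr ℝ (fun i => c i) : (Fin d → ℝ) →ₗ[ℝ] ℝ)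
  refine ⟨e, fun s hs => ?_⟩
  rw [← he]
  have hs' : s ∈ h'.extend (Set.subset_univ _) := h'.subset_extend _ hs
  have : B ⟨s, hs'⟩ = s := by simp [B]
  conv_lhs => rw [← this]
  rw [Module.Basis.constr_basis]

lemma LI.card_le {d : ℕ} {S : Finset (Fin d → ℝ)} (h : LI S) : S.card ≤ d := by
  have h' : LinearIndependent ℝ (fun x : ↥(S : Set (Fin d → ℝ)) => (x : Fin d → ℝ)) := h
  have := h'.fintype_card_le_finrank
  simpa using this

lemma LI.mono {d : ℕ} {S T : Finset (Fin d → ℝ)} (h : LI T) (hs : S ⊆ T) : LI S :=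
  LinearIndepOn.mono h (by exact_mod_cast hs)

lemma LI.exists_sep {d : ℕ} {S : Finset (Fin d → ℝ)} (h : LI S) {z : Fin d → ℝ}
    (hz : z ∉ Submodule.span ℝ (S : Set (Fin d → ℝ))) :
    ∃ e : Fin d → ℝ, (∀ s ∈ S, e ⬝ᵥ s = 0) ∧ e ⬝ᵥ z = 1 := by
  classical
  have h2 : LI (insert z S) := by
    have := LinearIndepOn.id_insert h hz
    unfold LI
    simpa using this
  obtain ⟨e, he⟩ := h2.exists_dual (fun x => if x = z then 1 else 0)
  refine ⟨e, fun s hs => ?_, ?_⟩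
  · rw [he s (by simp [hs]), if_neg]
    rintro rfl
    exact hz (Submodule.subset_span (by simpa using hs))
  · simpa using he z (by simp)

/-- perturbation lemma -/
lemma perturb {d : ℕ} {W : Finset (Fin d → ℝ)} {y e : Fin d → ℝ} (hy : Pol W y)
    (he : ∀ t ∈ tightS W y, e ⬝ᵥ t ≤ 0) :
    ∃ ε : ℝ, 0 < ε ∧ Pol W (y + ε • e) ∧
      ∀ w, w ∈ tightS W (y + ε • e) ↔ w ∈ tightS W y ∧ e ⬝ᵥ w = 0 := by
  have key : ∀ᶠ ε in nhdsWithin (0 : ℝ) (Set.Ioi 0),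
      ∀ w ∈ W, y ⬝ᵥ w < 1 → (y + ε • e) ⬝ᵥ w < 1 := by
    rw [Filter.eventually_all_finset]
    intro w hw
    by_cases h : y ⬝ᵥ w < 1
    · have hc : Continuous (fun ε : ℝ => (y + ε • e) ⬝ᵥ w) := by
        simp only [add_dotProduct, smul_dotProduct]; fun_prop
      have h0 : (y + (0 : ℝ) • e) ⬝ᵥ w < 1 := by simpa using h
      have := (hc.tendsto 0).eventually (gt_mem_nhds h0)
      exact (this.filter_mono nhdsWithin_le_nhds).mono fun _ hx _ => hx
    · exact Filter.Eventually.of_forall fun _ h' => absurd h' h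
  obtain ⟨ε, hε, hpos⟩ := (key.and self_mem_nhdsWithin).exists
  have hpos : 0 < ε := hpos
  have hval : ∀ w, (y + ε • e) ⬝ᵥ w = y ⬝ᵥ w + ε * (e ⬝ᵥ w) := by
    intro w; simp [add_dotProduct, smul_dotProduct]
  refine ⟨ε, hpos, ?_, ?_⟩
  · intro w hw
    rcases lt_or_eq_of_le (hy w hw) with h | h
    · exact (hε w hw h).le
    · rw [hval]
      have := he w (mem_tightS.2 ⟨hw, h⟩)
      nlinarith
  · intro w
    rw [mem_tightS, mem_tightS]
    constructor
    · rintro ⟨hw, h⟩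
      rcases lt_or_eq_of_le (hy w hw) with h1 | h1
      · exact absurd h (hε w hw h1).ne
      · refine ⟨⟨hw, h1⟩, ?_⟩
        rw [hval, h1] at h
        have : ε * (e ⬝ᵥ w) = 0 := by linarith
        rcases mul_eq_zero.1 this with h2 | h2
        · exact absurd h2 hpos.ne'
        · exact h2
    · rintro ⟨⟨hw, h1⟩, h2⟩
      exact ⟨hw, by rw [hval, h1, h2]; ring⟩

section abstract

variable {d : ℕ} {W : Finset (Fin d → ℝ)}

lemma IsF.subset {S : Finset (Fin d → ℝ)} (h : IsF W S) : S ⊆ W := by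
  obtain ⟨y, _, rfl⟩ := h
  intro w hw
  exact (mem_tightS.1 hw).1

lemma IsF.down (H : ∀ S, IsF W S → LI S) {S T : Finset (Fin d → ℝ)} (hT : IsF W T)
    (hS : S ⊆ T) : IsF W S := by
  classical
  have hl := H T hT
  obtain ⟨y, hy, rfl⟩ := hT
  obtain ⟨e, he⟩ := hl.exists_dual (fun x => if x ∈ S then 0 else -1)
  obtain ⟨ε, _, h1, h2⟩ := perturb hy (e := e) (fun t ht => by rw [he t ht]; split_ifs <;> norm_num)
  refine ⟨_, h1, ?_⟩
  ext w
  rw [h2]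
  constructor
  · rintro ⟨h3, h4⟩
    rw [he w h3] at h4
    by_contra h5
    simp [h5] at h4
  · intro h
    exact ⟨hS h, by rw [he w (hS h)]; simp [h]⟩

open Classical in
/-- dual basis -/
def dualv (T : Finset (Fin d → ℝ)) (t : Fin d → ℝ) : Fin d → ℝ :=
  if h : ∃ e : Fin d → ℝ, ∀ s ∈ T, e ⬝ᵥ s = if s = t then 1 else 0 then h.choose else 0

open Classical in
lemma LI.dualv_spec {T : Finset (Fin d → ℝ)} (h : LI T) (t : Fin d → ℝ) :
    ∀ s ∈ T, dualv T t ⬝ᵥ s = if s = t then 1 else 0 := by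
  have h1 := h.exists_dual (fun s => if s = t then 1 else 0)
  unfold dualv
  rw [dif_pos h1]
  exact h1.choose_spec

lemma LI.span_top {T : Finset (Fin d → ℝ)} (h : LI T) (hc : T.card = d) :
    Submodule.span ℝ (T : Set (Fin d → ℝ)) = ⊤ := by
  have h' : LinearIndependent ℝ (fun x : ↥(T : Set (Fin d → ℝ)) => (x : Fin d → ℝ)) := h
  have := h'.span_eq_top_of_card_eq_finrank' (by simpa using hc)
  simpa using this

lemma LI.expand {T : Finset (Fin d → ℝ)} (h : LI T) (hc : T.card = d) (z : Fin d → ℝ) :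
    z = ∑ t ∈ T, (dualv T t ⬝ᵥ z) • t := by
  classical
  have hz : z ∈ Submodule.span ℝ (T : Set (Fin d → ℝ)) := by rw [h.span_top hc]; trivial
  rw [Submodule.mem_span_finset] at hz
  obtain ⟨f, _, hf⟩ := hz
  have : ∀ t ∈ T, dualv T t ⬝ᵥ z = f t := by
    intro t ht
    rw [← hf, dotProduct_sum]
    rw [Finset.sum_eq_single t]
    · rw [dotProduct_smul, h.dualv_spec t t ht]; simp
    · intro s hs hst
      rw [dotProduct_smul, h.dualv_spec t s hs]; simp [hst]
    · exact fun h => absurd ht h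
  conv_lhs => rw [← hf]
  exact Finset.sum_congr rfl fun t ht => by rw [this t ht]

open Classical in
def neg (z : Fin d → ℝ) (T : Finset (Fin d → ℝ)) : Finset (Fin d → ℝ) :=
  T.filter (fun t => dualv T t ⬝ᵥ z < 0)

def Gen (W : Finset (Fin d → ℝ)) (z : Fin d → ℝ) : Prop :=
  ∀ T ⊆ W, T.card < d → z ∉ Submodule.span ℝ (T : Set (Fin d → ℝ))

def Bd (W R : Finset (Fin d → ℝ)) (z : Fin d → ℝ) : Prop :=
  ∀ c : ℝ, Bornology.IsBounded {y | Pol W y ∧ (∀ s ∈ R, y ⬝ᵥ s = 1) ∧ c ≤ z ⬝ᵥ y}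

lemma neg_subset (z : Fin d → ℝ) (T : Finset (Fin d → ℝ)) : neg z T ⊆ T := by
  classical
  exact Finset.filter_subset _ _

lemma Gen.coord_ne {z : Fin d → ℝ} (hz : Gen W z) {T : Finset (Fin d → ℝ)} (hT : T ⊆ W)
    (h : LI T) (hc : T.card = d) {t : Fin d → ℝ} (ht : t ∈ T) : dualv T t ⬝ᵥ z ≠ 0 := by
  classical
  intro h0
  apply hz (T.erase t) ((Finset.erase_subset _ _).trans hT)
  · rw [Finset.card_erase_of_mem ht, hc]
    have : 0 < T.card := Finset.card_pos.2 ⟨t, ht⟩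
    omega
  · have := h.expand hc z
    rw [← Finset.add_sum_erase T _ ht, h0, zero_smul, zero_add] at this
    rw [this]
    exact Submodule.sum_mem _ fun s hs => Submodule.smul_mem _ _ (Submodule.subset_span hs)

lemma mem_neg {z : Fin d → ℝ} {T : Finset (Fin d → ℝ)} {t : Fin d → ℝ} :
    t ∈ neg z T ↔ t ∈ T ∧ dualv T t ⬝ᵥ z < 0 := by simp [neg]

/-- uniqueness of the top facet -/
lemma top_unique (H : ∀ S, IsF W S → LI S) {z : Fin d → ℝ} (hz : Gen W z)
    {S T T' : Finset (Fin d → ℝ)} (hT : IsF W T) (hT' : IsF W T') (hc : T.card = d)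
    (hc' : T'.card = d) (hS : S ⊆ T) (hS' : S ⊆ T') (hn : neg z T ⊆ S) (hn' : neg z T' ⊆ S) :
    T = T' := by
  have key : ∀ T T' : Finset (Fin d → ℝ), IsF W T → IsF W T' → T.card = d → T'.card = d →
      S ⊆ T → S ⊆ T' → neg z T ⊆ S → ∀ y y', Pol W y → tightS W y = T → Pol W y' →
      tightS W y' = T' → z ⬝ᵥ y' ≤ z ⬝ᵥ y ∧ (z ⬝ᵥ y' = z ⬝ᵥ y → T ⊆ T') := by
    intro T T' hT hT' hc hc' hS hS' hn y y' hy hyT hy' hyT'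
    have ex := (H T hT).expand hc z
    have e1 : z ⬝ᵥ y - z ⬝ᵥ y' = ∑ t ∈ T, (dualv T t ⬝ᵥ z) * (1 - y' ⬝ᵥ t) := by
      conv_lhs => rw [ex]
      rw [sum_dotProduct, sum_dotProduct, ← Finset.sum_sub_distrib]
      refine Finset.sum_congr rfl fun t ht => ?_
      rw [smul_dotProduct, smul_dotProduct, dotProduct_comm t y, dotProduct_comm t y']
      have : y ⬝ᵥ t = 1 := by rw [← hyT] at ht; exact (mem_tightS.1 ht).2
      rw [this]; simp; ring
    have nn : ∀ t ∈ T, 0 ≤ (dualv T t ⬝ᵥ z) * (1 - y' ⬝ᵥ t) := by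
      intro t ht
      by_cases hts : t ∈ neg z T
      · have : t ∈ T' := hS' (hn hts)
        rw [← hyT'] at this
        rw [(mem_tightS.1 this).2]; simp
      · rw [mem_neg] at hts
        push Not at hts
        exact mul_nonneg (hts ht) (by linarith [hy' t (hT.subset ht)])
    refine ⟨by linarith [Finset.sum_nonneg nn], fun heq t ht => ?_⟩
    have : ∑ t ∈ T, (dualv T t ⬝ᵥ z) * (1 - y' ⬝ᵥ t) = 0 := by linarith
    rw [Finset.sum_eq_zero_iff_of_nonneg nn] at this
    rcases mul_eq_zero.1 (this t ht) with h | h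
    · exact absurd h (hz.coord_ne hT.subset (H T hT) hc ht)
    · rw [← hyT', mem_tightS]
      exact ⟨hT.subset ht, by linarith⟩
  obtain ⟨y, hy, hyT⟩ := id hT
  obtain ⟨y', hy', hyT'⟩ := id hT'
  have k1 := key T T' hT hT' hc hc' hS hS' hn y y' hy hyT hy' hyT'
  have k2 := key T' T hT' hT hc' hc hS' hS hn' y' y hy' hyT' hy hyT
  have : z ⬝ᵥ y' = z ⬝ᵥ y := le_antisymm k1.1 k2.1
  exact subset_antisymm (k1.2 this) (k2.2 this.symm)

lemma top_exists (H : ∀ S, IsF W S → LI S) {z : Fin d → ℝ} (hz : Gen W z)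
    {R S : Finset (Fin d → ℝ)} (hb : Bd W R z) (hRS : R ⊆ S) (hS : IsF W S) :
    ∃ T, IsF W T ∧ T.card = d ∧ S ⊆ T ∧ neg z T ⊆ S := by
  classical
  obtain ⟨y0, hy0, hyS⟩ := id hS
  have hSW := hS.subset
  let A : Set (Fin d → ℝ) := {y | Pol W y ∧ (∀ s ∈ S, y ⬝ᵥ s = 1) ∧ z ⬝ᵥ y0 ≤ z ⬝ᵥ y}
  have hA0 : y0 ∈ A := ⟨hy0, fun s hs => by rw [← hyS] at hs; exact (mem_tightS.1 hs).2, le_rfl⟩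
  have hAb : Bornology.IsBounded A :=
    (hb (z ⬝ᵥ y0)).subset fun y hy => ⟨hy.1, fun s hs => hy.2.1 s (hRS hs), hy.2.2⟩
  have hAc : IsClosed A := by
    have e : A = (⋂ w ∈ W, {y : Fin d → ℝ | y ⬝ᵥ w ≤ 1}) ∩
        ((⋂ s ∈ S, {y : Fin d → ℝ | y ⬝ᵥ s = 1}) ∩ {y : Fin d → ℝ | z ⬝ᵥ y0 ≤ z ⬝ᵥ y}) := by
      ext y; simp [A, Pol]
    rw [e]
    refine IsClosed.inter (isClosed_biInter fun w _ => ?_)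
      (IsClosed.inter (isClosed_biInter fun w _ => ?_) ?_)
    · exact isClosed_le (by unfold dotProduct; fun_prop) (by fun_prop)
    · exact isClosed_eq (by unfold dotProduct; fun_prop) (by fun_prop)
    · exact isClosed_le (by fun_prop) (by unfold dotProduct; fun_prop)
  have hcomp : IsCompact A := Metric.isCompact_of_isClosed_isBounded hAc hAb
  obtain ⟨y, hyA, hmax⟩ := hcomp.exists_isMaxOn ⟨y0, hA0⟩
    (f := fun y => z ⬝ᵥ y) (by unfold dotProduct; fun_prop)
  set T := tightS W y with hTdef
  have hT : IsF W T := ⟨y, hyA.1, rfl⟩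
  have hLT := H T hT
  have hST : S ⊆ T := fun s hs => mem_tightS.2 ⟨hSW hs, hyA.2.1 s hs⟩
  -- no improving direction
  have imp : ∀ e : Fin d → ℝ, (∀ t ∈ T, e ⬝ᵥ t ≤ 0) → (∀ s ∈ S, e ⬝ᵥ s = 0) →
      e ⬝ᵥ z ≤ 0 := by
    intro e h1 h2
    by_contra h3
    push Not at h3
    obtain ⟨ε, hε, hp, ht⟩ := perturb hyA.1 h1
    have hv : z ⬝ᵥ (y + ε • e) = z ⬝ᵥ y + ε * (e ⬝ᵥ z) := by
      rw [dotProduct_add, dotProduct_smul, dotProduct_comm z e]; simp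
    have hmem : y + ε • e ∈ A := by
      refine ⟨hp, fun s hs => ?_, ?_⟩
      · rw [add_dotProduct, smul_dotProduct, h2 s hs, hyA.2.1 s hs]; simp
      · rw [hv]; have := hyA.2.2; nlinarith
    have h4 : z ⬝ᵥ (y + ε • e) ≤ z ⬝ᵥ y := hmax hmem
    rw [hv] at h4
    nlinarith
  have hspan : z ∈ Submodule.span ℝ (T : Set (Fin d → ℝ)) := by
    by_contra hcon
    obtain ⟨e, he1, he2⟩ := hLT.exists_sep hcon
    have := imp e (fun t ht => (he1 t ht).le) (fun s hs => he1 s (hST hs))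
    linarith
  have hcard : T.card = d := by
    by_contra hne
    exact hz T hT.subset (lt_of_le_of_ne hLT.card_le hne) hspan
  refine ⟨T, hT, hcard, hST, fun t ht => ?_⟩
  rw [mem_neg] at ht
  by_contra htS
  have := imp (-dualv T t) (fun s hs => ?_) (fun s hs => ?_)
  · rw [neg_dotProduct] at this; linarith
  · rw [neg_dotProduct, hLT.dualv_spec t s hs]; split_ifs <;> norm_num
  · rw [neg_dotProduct, hLT.dualv_spec t s (hST hs), if_neg]; simp
    rintro rfl; exact htS hs

end abstract


/-! ### counting -/

lemma card_interval {α : Type*} [DecidableEq α] {A T : Finset α} (h : A ⊆ T) (m : ℕ) :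
    #{S ∈ T.powerset | A ⊆ S ∧ S.card = m} =
      if A.card ≤ m then (T.card - A.card).choose (m - A.card) else 0 := by
  split_ifs with hm
  · rw [← Finset.card_sdiff_of_subset h, ← Finset.card_powersetCard]
    refine Finset.card_nbij' (fun S => S \ A) (fun S => S ∪ A) ?_ ?_ ?_ ?_
    · intro S hS
      simp only [coe_filter, mem_powerset, Set.mem_ofPred_eq] at hS
      rw [Finset.mem_coe, Finset.mem_powersetCard]
      refine ⟨Finset.sdiff_subset_sdiff hS.1 le_rfl, ?_⟩
      rw [Finset.card_sdiff_of_subset hS.2.1, hS.2.2]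
    · intro S hS
      rw [Finset.mem_coe, Finset.mem_powersetCard] at hS
      simp only [coe_filter, mem_powerset, Set.mem_ofPred_eq]
      refine ⟨Finset.union_subset (hS.1.trans Finset.sdiff_subset) h, Finset.subset_union_right, ?_⟩
      rw [Finset.card_union_of_disjoint, hS.2]
      · omega
      · exact Finset.disjoint_of_subset_left hS.1 Finset.sdiff_disjoint
    · intro S hS
      simp only [coe_filter, mem_powerset, Set.mem_ofPred_eq] at hS
      exact Finset.sdiff_union_of_subset hS.2.1
    · intro S hS
      rw [Finset.mem_coe, Finset.mem_powersetCard] at hS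
      have : Disjoint S A := Finset.disjoint_of_subset_left hS.1 Finset.sdiff_disjoint
      show (S ∪ A) \ A = S
      rw [Finset.union_sdiff_right]
      exact Finset.sdiff_eq_self_of_disjoint this
  · rw [Finset.card_eq_zero, Finset.filter_eq_empty_iff]
    rintro S _ ⟨h1, h2⟩
    exact hm (h2 ▸ Finset.card_le_card h1)

section abstract2

variable {d : ℕ} {W : Finset (Fin d → ℝ)}

open Classical in
def facesW (W : Finset (Fin d → ℝ)) : Finset (Finset (Fin d → ℝ)) :=
  W.powerset.filter (IsF W)

open Classical in
def facetsW (W : Finset (Fin d → ℝ)) : Finset (Finset (Fin d → ℝ)) :=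
  W.powerset.filter (fun T => IsF W T ∧ T.card = d)

lemma mem_facesW {S : Finset (Fin d → ℝ)} : S ∈ facesW W ↔ IsF W S := by
  simp only [facesW, mem_filter, mem_powerset, and_iff_right_iff_imp]
  exact fun h => h.subset

lemma mem_facetsW {S : Finset (Fin d → ℝ)} : S ∈ facetsW W ↔ IsF W S ∧ S.card = d := by
  simp only [facetsW, mem_filter, mem_powerset, and_iff_right_iff_imp]
  exact fun h => h.1.subset

open Classical in
def hR (W R : Finset (Fin d → ℝ)) (z : Fin d → ℝ) (k : ℕ) : ℕ :=
  #{T ∈ facetsW W | R ⊆ T ∧ (neg z T \ R).card = k}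

open Classical in
lemma count_faces (H : ∀ S, IsF W S → LI S) {z : Fin d → ℝ} (hz : Gen W z)
    {R : Finset (Fin d → ℝ)} (hb : Bd W R z) (i : ℕ) :
    #{S ∈ facesW W | R ⊆ S ∧ S.card = i + R.card} =
      ∑ k ∈ range (i + 1), (d - R.card - k).choose (i - k) * hR W R z k := by
  have e1 : {S ∈ facesW W | R ⊆ S ∧ S.card = i + R.card} =
      ({T ∈ facetsW W | R ⊆ T}).biUnion
        (fun T => {S ∈ T.powerset | (neg z T ∪ R) ⊆ S ∧ S.card = i + R.card}) := by
    ext S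
    simp only [mem_filter, mem_biUnion, mem_powerset, mem_facesW, mem_facetsW]
    constructor
    · rintro ⟨hS, hR, hc⟩
      obtain ⟨T, hT, hTc, hST, hn⟩ := top_exists H hz hb hR hS
      exact ⟨T, ⟨⟨hT, hTc⟩, hR.trans hST⟩, hST, Finset.union_subset hn hR, hc⟩
    · rintro ⟨T, ⟨⟨hT, hTc⟩, hR⟩, hST, hn, hc⟩
      exact ⟨hT.down H hST, Finset.subset_union_right.trans hn, hc⟩
  rw [e1, Finset.card_biUnion]
  · have e2 : ∀ T ∈ ({T ∈ facetsW W | R ⊆ T}),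
        #{S ∈ T.powerset | (neg z T ∪ R) ⊆ S ∧ S.card = i + R.card} =
        ∑ k ∈ range (i + 1), if (neg z T \ R).card = k then
          (d - R.card - k).choose (i - k) else 0 := by
      intro T hT
      simp only [mem_filter, mem_facetsW] at hT
      rw [card_interval (Finset.union_subset (neg_subset z T) hT.2)]
      have hcu : (neg z T ∪ R).card = (neg z T \ R).card + R.card := by
        rw [← Finset.sdiff_union_self_eq_union, Finset.card_union_of_disjoint Finset.sdiff_disjoint]
      rw [Finset.sum_ite_eq, hcu, hT.1.2]
      simp only [mem_range]
      have : (neg z T \ R).card + R.card ≤ i + R.card ↔ (neg z T \ R).card < i + 1 := by omega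
      simp only [this]
      congr 2 <;> omega
    rw [Finset.sum_congr rfl e2, Finset.sum_comm]
    refine Finset.sum_congr rfl fun k _ => ?_
    rw [← Finset.sum_filter, Finset.sum_const, Finset.filter_filter, smul_eq_mul, mul_comm]
    rfl
  · intro T hT T' hT' hne
    simp only [coe_filter, Set.mem_ofPred_eq, mem_facetsW] at hT hT'
    rw [Function.onFun, Finset.disjoint_left]
    intro S hS hS'
    simp only [mem_filter, mem_powerset] at hS hS'
    exact hne (top_unique H hz hT.1.1 hT'.1.1 hT.1.2 hT'.1.2 hS.1 hS'.1
      (Finset.subset_union_left.trans hS.2.1) (Finset.subset_union_left.trans hS'.2.1))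

lemma tri_unique {D : ℕ} {h h' : ℕ → ℕ}
    (e : ∀ i, ∑ k ∈ range (i + 1), (D - k).choose (i - k) * h k =
      ∑ k ∈ range (i + 1), (D - k).choose (i - k) * h' k) : ∀ k, h k = h' k := by
  intro k
  induction k using Nat.strong_induction_on with
  | _ k ih =>
    have := e k
    rw [Finset.sum_range_succ, Finset.sum_range_succ] at this
    rw [Finset.sum_congr rfl (g := fun x => (D - x).choose (k - x) * h' x)
      (fun x hx => by rw [ih x (Finset.mem_range.1 hx)])] at this
    simpa using this

lemma hR_indep (H : ∀ S, IsF W S → LI S) {z z' : Fin d → ℝ} (hz : Gen W z) (hz' : Gen W z')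
    {R : Finset (Fin d → ℝ)} (hb : Bd W R z) (hb' : Bd W R z') (k : ℕ) :
    hR W R z k = hR W R z' k := by
  refine tri_unique (D := d - R.card) (fun i => ?_) k
  rw [← count_faces H hz hb, ← count_faces H hz' hb']

lemma Pol.conv {y : Fin d → ℝ} (hy : Pol W y) {x : Fin d → ℝ}
    (hx : x ∈ convexHull ℝ (W : Set (Fin d → ℝ))) : y ⬝ᵥ x ≤ 1 := by
  have hc : Convex ℝ {x : Fin d → ℝ | y ⬝ᵥ x ≤ 1} := by
    have : IsLinearMap ℝ (fun x : Fin d → ℝ => y ⬝ᵥ x) :=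
      ⟨fun a b => dotProduct_add _ _ _, fun a b => by simp [dotProduct_smul]⟩
    exact convex_halfSpace_le this 1
  exact convexHull_min (fun w hw => hy w hw) hc hx

lemma Bd_of_interior {z : Fin d → ℝ}
    (hz : z ∈ interior (convexHull ℝ (W : Set (Fin d → ℝ)))) (R : Finset (Fin d → ℝ)) :
    Bd W R z := by
  intro c
  obtain ⟨r, hr, hball⟩ := Metric.isOpen_iff.1 isOpen_interior z hz
  refine (Metric.isBounded_closedBall (x := (0 : Fin d → ℝ)) (r := max 0 (2 * (1 - c) / r))).subset ?_
  rintro y ⟨hy, _, hc⟩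
  rw [mem_closedBall_zero_iff, pi_norm_le_iff_of_nonneg (le_max_left _ _)]
  intro i
  refine le_trans ?_ (le_max_right _ _)
  have key : ∀ σ : ℝ, |σ| ≤ 1 → c + (r / 2) * σ * y i ≤ 1 := by
    intro σ hσ
    have h1 : z + Pi.single i ((r / 2) * σ) ∈ Metric.ball z r := by
      rw [mem_ball_iff_norm, add_sub_cancel_left, Pi.norm_single, Real.norm_eq_abs, abs_mul,
        abs_of_pos (half_pos hr)]
      nlinarith [abs_nonneg σ]
    have h2 := hy.conv (interior_subset (hball h1))
    rw [dotProduct_add, dotProduct_single, dotProduct_comm y z] at h2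
    nlinarith
  rw [Real.norm_eq_abs, le_div_iff₀ hr]
  rcases abs_cases (y i) with ⟨h, _⟩ | ⟨h, _⟩
  · have := key 1 (by simp)
    rw [h]; linarith
  · have := key (-1) (by simp)
    rw [h]; linarith

lemma exists_gen {O : Set (Fin d → ℝ)} (hO : IsOpen O) (hne : O.Nonempty) :
    ∃ z ∈ O, Gen W z := by
  classical
  by_contra hcon
  push Not at hcon
  have hsub : O ⊆ ⋃ T ∈ W.powerset.filter (fun T => T.card < d),
      (Submodule.span ℝ (T : Set (Fin d → ℝ)) : Set (Fin d → ℝ)) := by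
    intro z hz
    have := hcon z hz
    unfold Gen at this
    push Not at this
    obtain ⟨T, h1, h2, h3⟩ := this
    simp only [Set.mem_iUnion]
    exact ⟨T, by simp [h1, h2], h3⟩
  have h0 : MeasureTheory.volume (⋃ T ∈ W.powerset.filter (fun T => T.card < d),
      (Submodule.span ℝ (T : Set (Fin d → ℝ)) : Set (Fin d → ℝ))) = 0 := by
    refine (MeasureTheory.measure_biUnion_null_iff (Finset.countable_toSet _)).2 ?_
    intro T hT
    apply MeasureTheory.Measure.addHaar_submodule
    intro htop
    have h1 := finrank_span_finset_le_card (R := ℝ) T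
    unfold Set.finrank at h1
    rw [htop, finrank_top] at h1
    simp at h1 hT
    omega
  have h1 := hO.measure_pos MeasureTheory.volume hne
  have := MeasureTheory.measure_mono_null hsub h0
  exact h1.ne' this

open Classical in
lemma sum_hR (z : Fin d → ℝ) (k : ℕ) :
    ∑ v ∈ W, hR W {v} z k = (k + 1) * hR W ∅ z (k + 1) + (d - k) * hR W ∅ z k := by
  have e1 : ∀ v ∈ W, hR W {v} z k =
      ∑ T ∈ facetsW W, if v ∈ T ∧ (neg z T \ {v}).card = k then 1 else 0 := by
    intro v _
    unfold hR
    rw [Finset.card_filter]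
    refine Finset.sum_congr rfl fun T _ => ?_
    simp
  have e2 : ∀ T ∈ facetsW W, (∑ v ∈ W, if v ∈ T ∧ (neg z T \ {v}).card = k then 1 else 0) =
      (k + 1) * (if (neg z T).card = k + 1 then 1 else 0) +
        (d - k) * (if (neg z T).card = k then 1 else 0) := by
    intro T hT
    rw [mem_facetsW] at hT
    rw [← Finset.card_filter]
    have hsub := neg_subset z T
    have : W.filter (fun v => v ∈ T ∧ (neg z T \ {v}).card = k) =
        (neg z T).filter (fun _ => (neg z T).card = k + 1) ∪
          (T \ neg z T).filter (fun _ => (neg z T).card = k) := by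
      ext v
      simp only [mem_filter, mem_union, mem_sdiff]
      have hTW : v ∈ T → v ∈ W := fun h => hT.1.subset h
      by_cases hv : v ∈ neg z T
      · have hp : 0 < (neg z T).card := Finset.card_pos.2 ⟨v, hv⟩
        rw [Finset.sdiff_singleton_eq_erase, Finset.card_erase_of_mem hv]
        have := hsub hv
        constructor
        · rintro ⟨_, _, h⟩
          exact Or.inl ⟨hv, by omega⟩
        · rintro (⟨_, h⟩ | ⟨⟨_, h⟩, _⟩)
          · exact ⟨hTW this, this, by omega⟩
          · exact absurd hv h
      · rw [Finset.sdiff_singleton_eq_erase, Finset.erase_eq_of_notMem hv]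
        constructor
        · rintro ⟨_, h1, h⟩
          exact Or.inr ⟨⟨h1, hv⟩, h⟩
        · rintro (⟨h, _⟩ | ⟨⟨h1, _⟩, h⟩)
          · exact absurd h hv
          · exact ⟨hTW h1, h1, h⟩
    rw [this, Finset.card_union_of_disjoint]
    · rw [Finset.filter_const, Finset.filter_const]
      have hc : (T \ neg z T).card = d - (neg z T).card := by
        rw [Finset.card_sdiff_of_subset hsub, hT.2]
      congr 1
      · split_ifs with h <;> simp [h]
      · split_ifs with h
        · rw [hc, h]; simp
        · simp
    · exact Finset.disjoint_of_subset_left (Finset.filter_subset _ _)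
        (Finset.disjoint_of_subset_right (Finset.filter_subset _ _) Finset.disjoint_sdiff)
  rw [Finset.sum_congr rfl e1, Finset.sum_comm, Finset.sum_congr rfl e2, Finset.sum_add_distrib,
    ← Finset.mul_sum, ← Finset.mul_sum, ← Finset.card_filter, ← Finset.card_filter]
  simp [hR]

end abstract2


section abstract3

variable {d : ℕ} {W : Finset (Fin d → ℝ)}

lemma mem_closure_int (hK : (interior (convexHull ℝ (W : Set (Fin d → ℝ)))).Nonempty)
    {x : Fin d → ℝ} (hx : x ∈ convexHull ℝ (W : Set (Fin d → ℝ))) :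
    x ∈ closure (interior (convexHull ℝ (W : Set (Fin d → ℝ)))) := by
  rw [(convex_convexHull ℝ _).closure_interior_eq_closure_of_nonempty_interior hK]
  exact subset_closure hx

/-- choose a generic functional in the interior with prescribed open condition near `x`. -/
lemma exists_gen_near (hK : (interior (convexHull ℝ (W : Set (Fin d → ℝ)))).Nonempty)
    {x : Fin d → ℝ} (hx : x ∈ convexHull ℝ (W : Set (Fin d → ℝ)))
    {O : Set (Fin d → ℝ)} (hO : IsOpen O) (hxO : x ∈ O) :
    ∃ z ∈ interior (convexHull ℝ (W : Set (Fin d → ℝ))), z ∈ O ∧ Gen W z := by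
  obtain ⟨z, hz, hg⟩ := exists_gen (W := W) (hO.inter isOpen_interior)
    (mem_closure_iff.1 (mem_closure_int hK hx) O hO hxO)
  exact ⟨z, hz.2, hz.1, hg⟩

lemma isOpen_coord (v : Fin d → ℝ) (σ : ℝ) :
    IsOpen {z : Fin d → ℝ | ∀ T ∈ facetsW W, v ∈ T → 0 < σ * (dualv T v ⬝ᵥ z)} := by
  have : {z : Fin d → ℝ | ∀ T ∈ facetsW W, v ∈ T → 0 < σ * (dualv T v ⬝ᵥ z)} =
      ⋂ T ∈ facetsW W, {z : Fin d → ℝ | v ∈ T → 0 < σ * (dualv T v ⬝ᵥ z)} := by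
    ext z; simp
  rw [this]
  refine isOpen_biInter_finset fun T _ => ?_
  by_cases h : v ∈ T
  · simp only [h, true_imp_iff]
    exact isOpen_lt (by fun_prop) (by unfold dotProduct; fun_prop)
  · simp [h]

lemma neg_neg' (H : ∀ S, IsF W S → LI S) {z : Fin d → ℝ} (hz : Gen W z)
    {T : Finset (Fin d → ℝ)} (hT : T ∈ facetsW W) :
    neg (-z) T = T \ neg z T := by
  rw [mem_facetsW] at hT
  ext t
  rw [mem_sdiff, mem_neg, mem_neg, dotProduct_neg]
  constructor
  · rintro ⟨h1, h2⟩
    exact ⟨h1, fun h => by linarith [h.2]⟩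
  · rintro ⟨h1, h2⟩
    have := hz.coord_ne hT.1.subset (H T hT.1) hT.2 h1
    refine ⟨h1, ?_⟩
    have h3 : ¬ (dualv T t ⬝ᵥ z < 0) := fun h => h2 ⟨h1, h⟩
    have : 0 < dualv T t ⬝ᵥ z := lt_of_le_of_ne (not_lt.1 h3) this.symm
    linarith

lemma Gen.neg' {z : Fin d → ℝ} (hz : Gen W z) : Gen W (-z) := by
  intro T h1 h2 h3
  exact hz T h1 h2 (by simpa using Submodule.neg_mem _ h3)

theorem upper_abstract (hd : 1 ≤ d) (H : ∀ S, IsF W S → LI S)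
    (hK : (interior (convexHull ℝ (W : Set (Fin d → ℝ)))).Nonempty)
    (Wf Wn : Finset (Fin d → ℝ)) (hW : Disjoint Wf Wn)
    (hWu : W = Wf ∪ Wn)
    (hf : ∀ w ∈ Wf, ∃ ε : ℝ, 0 < ε ∧ (-ε) • w ∈ convexHull ℝ (W : Set (Fin d → ℝ)))
    (hnf : ∀ w ∈ Wn, ∃ ε : ℝ, 0 < ε ∧ ε • w ∈ interior (convexHull ℝ (W : Set (Fin d → ℝ))))
    (h0 : (0 : Fin d → ℝ) ∉ interior (convexHull ℝ (W : Set (Fin d → ℝ)))) :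
    ∃ h : ℕ → ℕ,
      (∀ i, #{S ∈ facesW W | S.card = i} =
        ∑ k ∈ range (i + 1), (d - k).choose (i - k) * h k) ∧
      h 0 = 1 ∧ h d = 0 ∧
      (∀ k, (k + 1) * h (k + 1) + (d - k) * h k ≤ W.card * h k) ∧
      (∀ k < d, (k + 1) * h (d - 1 - k) + (d - k) * h (d - k) ≤
        Wf.card * h (d - k) + Wn.card * h k) := by
  obtain ⟨z, hzK, hzg⟩ := exists_gen (W := W) isOpen_interior hK
  have hbz := fun R => Bd_of_interior hzK R
  have hcnt : ∀ i, #{S ∈ facesW W | S.card = i} =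
        ∑ k ∈ range (i + 1), (d - k).choose (i - k) * hR W ∅ z k := by
    intro i
    have := count_faces H hzg (hbz ∅) i
    simpa using this
  -- first inequality
  have ineq1 : ∀ v ∈ W, ∀ k, hR W {v} z k ≤ hR W ∅ z k := by
    intro v hv k
    obtain ⟨z', hz'K, hz'O, hz'g⟩ := exists_gen_near hK (subset_convexHull ℝ _ hv)
      (isOpen_coord (W := W) v 1) (fun T hT hvT => by
        rw [mem_facetsW] at hT
        rw [(H T hT.1).dualv_spec v v hvT]; simp)
    rw [hR_indep H hzg hz'g (hbz _) (Bd_of_interior hz'K _),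
      hR_indep H hzg hz'g (hbz _) (Bd_of_interior hz'K _)]
    unfold hR
    refine Finset.card_le_card fun T hT => ?_
    simp only [mem_filter] at hT ⊢
    obtain ⟨hT, hvT, hc⟩ := hT
    refine ⟨hT, Finset.empty_subset _, ?_⟩
    have hpos := hz'O T hT (by simpa using hvT)
    have hv' : v ∉ neg z' T := fun h => by linarith [(mem_neg.1 h).2]
    rw [← hc, Finset.sdiff_empty, Finset.sdiff_singleton_eq_erase, Finset.erase_eq_of_notMem hv']
  -- second inequality
  have ineq2 : ∀ v ∈ Wf, ∀ k < d, hR W {v} z (d - 1 - k) ≤ hR W ∅ z (d - k) := by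
    intro v hv k hk
    obtain ⟨ε, hε, hmem⟩ := hf v hv
    obtain ⟨z', hz'K, hz'O, hz'g⟩ := exists_gen_near hK hmem
      (isOpen_coord (W := W) v (-1)) (fun T hT hvT => by
        rw [mem_facetsW] at hT
        rw [dotProduct_smul, (H T hT.1).dualv_spec v v hvT]; simpa using hε)
    rw [hR_indep H hzg hz'g (hbz _) (Bd_of_interior hz'K _),
      hR_indep H hzg hz'g (hbz _) (Bd_of_interior hz'K _)]
    unfold hR
    refine Finset.card_le_card fun T hT => ?_
    simp only [mem_filter] at hT ⊢
    obtain ⟨hT, hvT, hc⟩ := hT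
    refine ⟨hT, Finset.empty_subset _, ?_⟩
    have hvT' : v ∈ T := by simpa using hvT
    have hpos := hz'O T hT hvT'
    have hv' : v ∈ neg z' T := mem_neg.2 ⟨hvT', by linarith⟩
    rw [Finset.sdiff_singleton_eq_erase, Finset.card_erase_of_mem hv'] at hc
    have : 0 < (neg z' T).card := Finset.card_pos.2 ⟨v, hv'⟩
    rw [Finset.sdiff_empty]
    omega
  -- third inequality
  have ineq3 : ∀ v ∈ Wn, ∀ k < d, hR W {v} z (d - 1 - k) ≤ hR W ∅ z k := by
    intro v hv k hk
    have hvW : v ∈ W := by rw [hWu]; exact Finset.mem_union_right _ hv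
    obtain ⟨ε, hε, hmem⟩ := hnf v hv
    have hb : Bd W {v} (-z) := by
      intro c
      refine (Bd_of_interior hmem ∅ ε).subset ?_
      rintro y ⟨h1, h2, _⟩
      refine ⟨h1, by simp, ?_⟩
      have := h2 v (by simp)
      rw [smul_dotProduct, dotProduct_comm, this]; simp
    have e : hR W {v} z (d - 1 - k) = hR W {v} z k := by
      rw [hR_indep H hzg hzg.neg' (hbz _) hb k]
      unfold hR
      congr 1
      ext T
      simp only [mem_filter]
      refine and_congr_right fun hT => and_congr_right fun hvT => ?_
      have hvT' : v ∈ T := by simpa using hvT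
      have hcT := (mem_facetsW.1 hT).2
      rw [neg_neg' H hzg hT]
      have e1 : (T \ neg z T) \ {v} = (T.erase v) \ (neg z T \ {v}) := by
        ext t; simp only [mem_sdiff, mem_singleton, mem_erase]; tauto
      have e2 : (neg z T \ {v}) ⊆ T.erase v := by
        intro t; simp only [mem_sdiff, mem_singleton, mem_erase]
        exact fun h => ⟨h.2, neg_subset _ _ h.1⟩
      have e3 := Finset.card_le_card e2
      rw [e1, Finset.card_sdiff_of_subset e2]
      rw [Finset.card_erase_of_mem hvT', hcT] at e3 ⊢
      omega
    rw [e]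
    exact ineq1 v hvW k
  refine ⟨hR W ∅ z, hcnt, ?_, ?_, ?_, ?_⟩
  · have h1 := hcnt 0
    simp only [zero_add, range_one, sum_singleton, Nat.sub_self, Nat.choose_zero_right,
      one_mul] at h1
    rw [← h1, Finset.card_eq_one]
    refine ⟨∅, ?_⟩
    ext S
    simp only [mem_filter, Finset.card_eq_zero, mem_singleton, and_iff_right_iff_imp]
    rintro rfl
    rw [mem_facesW]
    refine ⟨0, fun w _ => by simp, ?_⟩
    ext w; simp [mem_tightS]
  · unfold hR
    rw [Finset.card_eq_zero, Finset.filter_eq_empty_iff]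
    rintro T hT ⟨_, hc⟩
    rw [Finset.sdiff_empty] at hc
    rw [mem_facetsW] at hT
    have hall : neg z T = T := Finset.eq_of_subset_of_card_le (neg_subset z T) (by omega)
    have hLT := H T hT.1
    have hlam : ∀ t ∈ T, dualv T t ⬝ᵥ z < 0 := fun t ht => by
      rw [← hall] at ht; exact (mem_neg.1 ht).2
    have hex := hLT.expand hT.2 z
    set c : ℝ := ∑ t ∈ T, -(dualv T t ⬝ᵥ z) with hcdef
    have hTne : T.Nonempty := Finset.card_pos.1 (by omega)
    have hcpos : 0 < c := Finset.sum_pos (fun t ht => by linarith [hlam t ht]) hTne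
    have hu : ∑ t ∈ T, (-(dualv T t ⬝ᵥ z) / c) • t ∈ convexHull ℝ (W : Set (Fin d → ℝ)) := by
      refine (convex_convexHull ℝ _).sum_mem (fun t ht => ?_) ?_ (fun t ht => ?_)
      · exact div_nonneg (by linarith [hlam t ht]) hcpos.le
      · rw [← Finset.sum_div, ← hcdef, div_self hcpos.ne']
      · exact subset_convexHull ℝ _ (hT.1.subset ht)
    have hzu : ∑ t ∈ T, (-(dualv T t ⬝ᵥ z) / c) • t = (-(1 / c)) • z := by
      conv_rhs => rw [hex]
      rw [Finset.smul_sum]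
      refine Finset.sum_congr rfl fun t _ => ?_
      rw [smul_smul]; congr 1; ring
    have := (convex_convexHull ℝ (W : Set (Fin d → ℝ))).combo_interior_self_mem_interior hzK hu
      (a := 1 / (1 + c)) (b := c / (1 + c)) (by positivity) (by positivity) (by field_simp)
    apply h0
    convert this using 1
    rw [hzu, smul_smul, ← add_smul]
    have : 1 / (1 + c) + c / (1 + c) * -(1 / c) = 0 := by field_simp; ring
    rw [this, zero_smul]
  · intro k
    rw [← sum_hR z k, ← smul_eq_mul, ← Finset.sum_const]
    exact Finset.sum_le_sum fun v hv => ineq1 v hv k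
  · intro k hk
    have e := sum_hR (W := W) z (d - 1 - k)
    have e1 : d - 1 - k + 1 = d - k := by omega
    have e2 : d - (d - 1 - k) = k + 1 := by omega
    rw [e1, e2] at e
    rw [add_comm, ← e]
    have e3 : ∑ v ∈ W, hR W {v} z (d - 1 - k) =
        ∑ v ∈ Wf, hR W {v} z (d - 1 - k) + ∑ v ∈ Wn, hR W {v} z (d - 1 - k) := by
      rw [← Finset.sum_union hW, ← hWu]
    rw [e3, ← smul_eq_mul Wf.card, ← smul_eq_mul Wn.card,
      ← Finset.sum_const, ← Finset.sum_const]
    exact add_le_add (Finset.sum_le_sum fun v hv => ineq2 v hv k hk)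
      (Finset.sum_le_sum fun v hv => ineq3 v hv k hk)

end abstract3


section numeric

lemma mc_rec (N k : ℕ) :
    (k + 1) * Nat.multichoose N (k + 1) = (N + k) * Nat.multichoose N k := by
  rcases N with _ | N
  · rcases k with _ | k <;> simp
  · rw [Nat.multichoose_eq, Nat.multichoose_eq]
    have e1 : N + 1 + (k + 1) - 1 = N + k + 1 := by omega
    have e2 : N + 1 + k - 1 = N + k := by omega
    rw [e1, e2, mul_comm, ← Nat.add_one_mul_choose_eq]
    ring

/-- the upper bound for the `h`-vector. -/
def Bc (d s q k : ℕ) : ℕ :=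
  if 2 * k < d then Nat.multichoose (s + q) k
  else Nat.multichoose (s + q) (d - k) - Nat.multichoose s (d - k)

lemma numeric {d s q : ℕ} {h : ℕ → ℕ} (h0 : h 0 = 1) (hd : h d = 0)
    (h1 : ∀ k, (k + 1) * h (k + 1) + (d - k) * h k ≤ (d + s + q) * h k)
    (h2 : ∀ k < d, (k + 1) * h (d - 1 - k) + (d - k) * h (d - k) ≤
        (d + s) * h (d - k) + q * h k) : ∀ k ≤ d, h k ≤ Bc d s q k := by
  have H1 : ∀ k ≤ d, h k ≤ Nat.multichoose (s + q) k := by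
    intro k
    induction k with
    | zero => intro _; simp [h0]
    | succ k ih =>
      intro hk
      replace ih := ih (by omega)
      have := h1 k
      obtain ⟨e, he⟩ : ∃ e, d = k + e := ⟨d - k, by omega⟩
      have e1 : d - k = e := by omega
      rw [e1] at this
      subst he
      have h3 : (k + 1) * h (k + 1) ≤ (s + q + k) * h k := by nlinarith
      refine Nat.le_of_mul_le_mul_left (c := k + 1) ?_ (by omega)
      rw [mc_rec]
      exact h3.trans (Nat.mul_le_mul_left _ ih)
  have H2 : ∀ k ≤ d, h (d - k) + Nat.multichoose s k ≤ Nat.multichoose (s + q) k := by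
    intro k
    induction k with
    | zero => intro _; simp [hd]
    | succ k ih =>
      intro hk
      replace ih := ih (by omega)
      have := h2 k (by omega)
      have hh := H1 k (by omega)
      obtain ⟨e, he⟩ : ∃ e, d = k + e := ⟨d - k, by omega⟩
      have e1 : d - k = e := by omega
      have e2 : d - 1 - k = d - (k + 1) := by omega
      rw [e2, e1] at this
      rw [e1] at ih
      set a := h e
      set b := h (d - (k + 1))
      have h3 : (k + 1) * b ≤ (s + k) * a + q * h k := by
        subst he; nlinarith
      refine Nat.le_of_mul_le_mul_left (c := k + 1) ?_ (by omega)
      rw [mul_add, mc_rec, mc_rec]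
      nlinarith
  intro k hk
  unfold Bc
  split_ifs
  · exact H1 k hk
  · have := H2 (d - k) (by omega)
    rw [show d - (d - k) = k by omega] at this
    omega

end numeric


section core

variable {d : ℕ} {W : Finset (Fin d → ℝ)}

lemma dot_zero_span {S : Set (Fin d → ℝ)} {e : Fin d → ℝ} (h : ∀ s ∈ S, e ⬝ᵥ s = 0)
    {x : Fin d → ℝ} (hx : x ∈ Submodule.span ℝ S) : e ⬝ᵥ x = 0 := by
  induction hx using Submodule.span_induction with
  | mem x hx => exact h x hx
  | zero => simp
  | add x y _ _ h1 h2 => rw [dotProduct_add, h1, h2, add_zero]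
  | smul a x _ h1 => rw [dotProduct_smul, h1, smul_zero]

lemma eq_zero_of_span {S : Set (Fin d → ℝ)} (hS : Submodule.span ℝ S = ⊤)
    {e : Fin d → ℝ} (h : ∀ s ∈ S, e ⬝ᵥ s = 0) : e = 0 := by
  have := dot_zero_span h (x := e) (by rw [hS]; trivial)
  exact dotProduct_self_eq_zero.1 this

lemma dot_conv_le {S : Set (Fin d → ℝ)} {b : Fin d → ℝ} {c : ℝ} (h : ∀ s ∈ S, b ⬝ᵥ s ≤ c)
    {x : Fin d → ℝ} (hx : x ∈ convexHull ℝ S) : b ⬝ᵥ x ≤ c := by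
  have hc : Convex ℝ {x : Fin d → ℝ | b ⬝ᵥ x ≤ c} := by
    have : IsLinearMap ℝ (fun x : Fin d → ℝ => b ⬝ᵥ x) :=
      ⟨fun a b => dotProduct_add _ _ _, fun a b => by simp [dotProduct_smul]⟩
    exact convex_halfSpace_le this c
  exact convexHull_min (fun w hw => h w hw) hc hx

lemma span_of_interior (hK : (interior (convexHull ℝ (W : Set (Fin d → ℝ)))).Nonempty) :
    Submodule.span ℝ (W : Set (Fin d → ℝ)) = ⊤ := by
  rw [interior_convexHull_nonempty_iff_affineSpan_eq_top] at hK
  have h1 : vectorSpan ℝ (W : Set (Fin d → ℝ)) = ⊤ := by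
    rw [← direction_affineSpan, hK, AffineSubspace.direction_top]
  rw [eq_top_iff, ← h1, vectorSpan_def]
  refine Submodule.span_le.2 ?_
  rintro _ ⟨x, hx, y, hy, rfl⟩
  exact Submodule.sub_mem _ (Submodule.subset_span hx) (Submodule.subset_span hy)

/-- move to a functional whose tight set spans. -/
lemma exists_tight_top (hW : Submodule.span ℝ (W : Set (Fin d → ℝ)) = ⊤) {y : Fin d → ℝ}
    (hy : Pol W y) : ∃ y', Pol W y' ∧ tightS W y ⊆ tightS W y' ∧
      Submodule.span ℝ (tightS W y' : Set (Fin d → ℝ)) = ⊤ := by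
  classical
  -- maximal cardinality
  obtain ⟨m, ⟨y1, hy1, hsub, hm⟩, hmax⟩ : ∃ m, (∃ y', Pol W y' ∧ tightS W y ⊆ tightS W y' ∧
      (tightS W y').card = m) ∧ ∀ y', Pol W y' → tightS W y ⊆ tightS W y' →
      (tightS W y').card ≤ m := by
    have hb : ∃ m, ∃ y', Pol W y' ∧ tightS W y ⊆ tightS W y' ∧ (tightS W y').card = m :=
      ⟨_, y, hy, subset_rfl, rfl⟩
    let p : ℕ → Prop := fun m =>
      ∃ y', Pol W y' ∧ tightS W y ⊆ tightS W y' ∧ (tightS W y').card = m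
    have hle : ∀ m, p m → m ≤ W.card := by
      rintro m ⟨y', _, _, rfl⟩
      exact Finset.card_le_card (Finset.filter_subset _ _)
    obtain ⟨m0, hm0⟩ := hb
    refine ⟨Nat.findGreatest p W.card, ?_, ?_⟩
    · exact Nat.findGreatest_spec (P := p) (hle m0 hm0) hm0
    · intro y' h1 h2
      exact Nat.le_findGreatest (P := p) (hle _ ⟨y', h1, h2, rfl⟩) ⟨y', h1, h2, rfl⟩
  refine ⟨y1, hy1, hsub, ?_⟩
  by_contra hne
  obtain ⟨f, hf0, hfk⟩ := Submodule.exists_le_ker_of_lt_top _ (lt_top_iff_ne_top.2 hne)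
  obtain ⟨e, he⟩ := exists_vec f
  have he1 : ∀ t ∈ tightS W y1, e ⬝ᵥ t = 0 := by
    intro t ht
    rw [← he]
    exact hfk (Submodule.subset_span ht)
  have he0 : e ≠ 0 := by
    rintro rfl
    apply hf0; ext x; simp [he]
  obtain ⟨w, hw, hew⟩ : ∃ w ∈ W, e ⬝ᵥ w ≠ 0 := by
    by_contra hcon
    push Not at hcon
    exact he0 (eq_zero_of_span hW hcon)
  obtain ⟨e, he1, hew⟩ : ∃ e : Fin d → ℝ, (∀ t ∈ tightS W y1, e ⬝ᵥ t = 0) ∧ 0 < e ⬝ᵥ w := by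
    rcases lt_or_gt_of_ne hew with h | h
    · exact ⟨-e, fun t ht => by rw [neg_dotProduct, he1 t ht, neg_zero],
        by rw [neg_dotProduct]; linarith⟩
    · exact ⟨e, he1, h⟩
  obtain ⟨w1, hw1, hmin⟩ := Finset.exists_min_image (W.filter (fun w => 0 < e ⬝ᵥ w))
    (fun w => (1 - y1 ⬝ᵥ w) / (e ⬝ᵥ w)) ⟨w, by simp [hw, hew]⟩
  rw [mem_filter] at hw1
  set ε := (1 - y1 ⬝ᵥ w1) / (e ⬝ᵥ w1) with hε
  have hε0 : 0 ≤ ε := div_nonneg (by linarith [hy1 w1 hw1.1]) hw1.2.le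
  have hP : Pol W (y1 + ε • e) := by
    intro w hw
    rw [add_dotProduct, smul_dotProduct, smul_eq_mul]
    by_cases h : 0 < e ⬝ᵥ w
    · have := hmin w (by simp [hw, h])
      rw [le_div_iff₀ h] at this
      linarith
    · have := hy1 w hw
      nlinarith
  have hin : insert w1 (tightS W y1) ⊆ tightS W (y1 + ε • e) := by
    intro t ht
    rw [mem_tightS, add_dotProduct, smul_dotProduct, smul_eq_mul]
    rcases Finset.mem_insert.1 ht with rfl | ht
    · refine ⟨hw1.1, ?_⟩
      rw [hε, div_mul_cancel₀ _ hw1.2.ne']; ring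
    · have := mem_tightS.1 ht
      rw [he1 t ht]
      exact ⟨this.1, by linarith [this.2]⟩
  have hn : w1 ∉ tightS W y1 := fun h => by
    have := he1 w1 h
    linarith [hw1.2]
  have h1 := Finset.card_le_card hin
  rw [Finset.card_insert_of_notMem hn] at h1
  have h2 := hmax _ hP (hsub.trans ((Finset.subset_insert _ _).trans hin))
  omega

lemma LI_of_top {S : Finset (Fin d → ℝ)} (h : Submodule.span ℝ (S : Set (Fin d → ℝ)) = ⊤)
    (hc : S.card = d) : LI S := by
  have := linearIndependent_of_top_le_span_of_card_eq_finrank (R := ℝ)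
    (b := fun x : ↥(S : Set (Fin d → ℝ)) => (x : Fin d → ℝ)) (by simp [h]) (by simpa using hc)
  exact this

/-- hypotheses describing `W`: the vertices of an almost simplicial polytope, translated
so that the centroid of the special facet is the origin. -/
structure Setup (d : ℕ) (W : Finset (Fin d → ℝ)) (b : Fin d → ℝ) : Prop where
  hK : (interior (convexHull ℝ (W : Set (Fin d → ℝ)))).Nonempty
  hb0 : b ≠ 0
  hb : ∀ w ∈ W, b ⬝ᵥ w ≤ 0
  hsum : ∑ w ∈ W with b ⬝ᵥ w = 0, w = 0
  hne : ∃ w ∈ W, b ⬝ᵥ w = 0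
  hdim : d - 1 ≤ Module.finrank ℝ (Submodule.span ℝ ({w ∈ W | b ⬝ᵥ w = 0} : Set (Fin d → ℝ)))
  hsimp : ∀ y, Pol W y → Submodule.span ℝ (tightS W y : Set (Fin d → ℝ)) = ⊤ →
    (tightS W y).card = d

variable {b : Fin d → ℝ}

lemma Setup.H (h : Setup d W b) : ∀ S, IsF W S → LI S := by
  rintro S ⟨y, hy, rfl⟩
  obtain ⟨y', h1, h2, h3⟩ := exists_tight_top (span_of_interior h.hK) hy
  exact (LI_of_top h3 (h.hsimp y' h1 h3)).mono h2

lemma Setup.normal (h : Setup d W b) {g : Fin d → ℝ} (hg : ∀ w ∈ W, g ⬝ᵥ w ≤ 0) :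
    ∃ μ : ℝ, 0 ≤ μ ∧ g = μ • b := by
  classical
  have hg0 : ∀ w ∈ W, b ⬝ᵥ w = 0 → g ⬝ᵥ w = 0 := by
    have h1 : ∑ w ∈ W with b ⬝ᵥ w = 0, g ⬝ᵥ w = 0 := by
      rw [← dotProduct_sum, h.hsum, dotProduct_zero]
    have h2 := (Finset.sum_eq_zero_iff_of_nonpos (fun w hw => hg w (mem_filter.1 hw).1)).1 h1
    exact fun w hw hbw => h2 w (by simp [hw, hbw])
  obtain ⟨v, hv, hbv⟩ : ∃ w ∈ W, b ⬝ᵥ w ≠ 0 := by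
    by_contra hcon
    push Not at hcon
    exact h.hb0 (eq_zero_of_span (span_of_interior h.hK) hcon)
  have hbv : b ⬝ᵥ v < 0 := lt_of_le_of_ne (h.hb v hv) hbv
  set U : Set (Fin d → ℝ) := {w ∈ W | b ⬝ᵥ w = 0} with hU
  have htop : Submodule.span ℝ (insert v U) = ⊤ := by
    have hlt : Submodule.span ℝ U < Submodule.span ℝ (insert v U) := by
      refine lt_of_le_of_ne (Submodule.span_mono (Set.subset_insert _ _)) fun he => ?_
      have : v ∈ Submodule.span ℝ U := by
        rw [he]; exact Submodule.subset_span (Set.mem_insert _ _)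
      have := dot_zero_span (e := b) (fun s hs => hs.2) this
      linarith
    have h1 := Submodule.finrank_lt_finrank_of_lt hlt
    have h2 : d - 1 ≤ Module.finrank ℝ (Submodule.span ℝ U) := h.hdim
    have h3 := Submodule.finrank_le (Submodule.span ℝ (insert v U))
    apply Submodule.eq_top_of_finrank_eq
    simp only [Module.finrank_fintype_fun_eq_card, Fintype.card_fin] at h3 ⊢
    omega
  refine ⟨(g ⬝ᵥ v) / (b ⬝ᵥ v), div_nonneg_of_nonpos (hg v hv) hbv.le, ?_⟩
  rw [← sub_eq_zero]
  refine eq_zero_of_span htop ?_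
  rintro s (rfl | hs)
  · rw [sub_dotProduct, smul_dotProduct, smul_eq_mul, div_mul_cancel₀ _ hbv.ne, sub_self]
  · rw [sub_dotProduct, smul_dotProduct, hs.2, hg0 s hs.1 hs.2]; simp

lemma Setup.zero_mem (h : Setup d W b) : (0 : Fin d → ℝ) ∈ convexHull ℝ (W : Set (Fin d → ℝ)) := by
  classical
  obtain ⟨w, hw, hbw⟩ := h.hne
  set m : ℕ := #{w ∈ W | b ⬝ᵥ w = 0} with hm
  have hm0 : 0 < m := Finset.card_pos.2 ⟨w, by simp [hw, hbw]⟩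
  have := (convex_convexHull ℝ (W : Set (Fin d → ℝ))).sum_mem (t := {w ∈ W | b ⬝ᵥ w = 0})
    (w := fun _ => (1 / m : ℝ)) (z := fun w => w) (fun _ _ => by positivity)
    (by rw [Finset.sum_const, ← hm, nsmul_eq_mul]; field_simp)
    (fun w hw => subset_convexHull ℝ _ (mem_filter.1 hw).1)
  rwa [← Finset.smul_sum, h.hsum, smul_zero] at this

theorem Setup.bound (h : Setup d W b) (hd : 1 ≤ d) {s q : ℕ}
    (hs : #{w ∈ W | b ⬝ᵥ w = 0} = d + s) (hq : W.card = d + s + q) :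
    ∀ i ≤ d, #{S ∈ facesW W | S.card = i} ≤
        ∑ k ∈ range (i + 1), (d - k).choose (i - k) * Bc d s q k := by
  classical
  have hWu : W = {w ∈ W | b ⬝ᵥ w = 0} ∪ {w ∈ W | ¬ b ⬝ᵥ w = 0} :=
    (Finset.filter_union_filter_not_eq _ _).symm
  have hdis : Disjoint {w ∈ W | b ⬝ᵥ w = 0} {w ∈ W | ¬ b ⬝ᵥ w = 0} :=
    Finset.disjoint_filter_filter_not _ _ _
  have hcn : #{w ∈ W | ¬ b ⬝ᵥ w = 0} = q := by
    have := congrArg Finset.card hWu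
    rw [Finset.card_union_of_disjoint hdis] at this
    omega
  have p1 : ∀ w ∈ ({w ∈ W | b ⬝ᵥ w = 0} : Finset (Fin d → ℝ)), ∃ ε : ℝ, 0 < ε ∧
      (-ε) • w ∈ convexHull ℝ (W : Set (Fin d → ℝ)) := by
    intro w hw
    obtain ⟨m, hm⟩ : ∃ m : ℕ, m = #{w ∈ W | b ⬝ᵥ w = 0} := ⟨_, rfl⟩
    have hm0 : 0 < m := by rw [hm]; exact Finset.card_pos.2 ⟨w, hw⟩
    clear hs hWu hdis
    refine ⟨1 / m, by positivity, ?_⟩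
    have := (convex_convexHull ℝ (W : Set (Fin d → ℝ))).sum_mem (t := {w ∈ W | b ⬝ᵥ w = 0})
      (w := fun _ => (1 / m : ℝ)) (z := fun w' => if w' = w then 0 else w')
      (fun _ _ => by positivity)
      (by rw [Finset.sum_const, ← hm, nsmul_eq_mul]; field_simp)
      (fun w' hw' => by
        split_ifs
        · exact h.zero_mem
        · exact subset_convexHull ℝ _ (mem_filter.1 hw').1)
    rw [← Finset.smul_sum] at this
    convert this using 1
    have e : ∑ w' ∈ W with b ⬝ᵥ w' = 0, (if w' = w then 0 else w') =
        ∑ w' ∈ W with b ⬝ᵥ w' = 0, w' - ∑ w' ∈ W with b ⬝ᵥ w' = 0, (if w' = w then w' else 0) := by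
      rw [← Finset.sum_sub_distrib]
      refine Finset.sum_congr rfl fun w' _ => ?_
      split_ifs <;> simp
    rw [e, h.hsum, Finset.sum_ite_eq', if_pos hw]
    simp
  have p2 : ∀ w ∈ ({w ∈ W | ¬ b ⬝ᵥ w = 0} : Finset (Fin d → ℝ)), ∃ ε : ℝ, 0 < ε ∧
      ε • w ∈ interior (convexHull ℝ (W : Set (Fin d → ℝ))) := by
    intro w hw
    rw [mem_filter] at hw
    refine ⟨1 / 2, by norm_num, ?_⟩
    by_contra hcon
    obtain ⟨f, hf⟩ := geometric_hahn_banach_open_point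
      (convex_convexHull ℝ (W : Set (Fin d → ℝ))).interior isOpen_interior hcon
    have hle : ∀ x ∈ convexHull ℝ (W : Set (Fin d → ℝ)), f x ≤ f ((1 / 2 : ℝ) • w) := by
      intro x hx
      have hx := mem_closure_int h.hK hx
      have : interior (convexHull ℝ (W : Set (Fin d → ℝ))) ⊆ {x | f x ≤ f ((1 / 2 : ℝ) • w)} :=
        fun a ha => (hf a ha).le
      exact closure_minimal this (isClosed_le f.continuous continuous_const) hx
    have h1 := hle 0 h.zero_mem
    have h2 := hle w (subset_convexHull ℝ _ hw.1)
    rw [map_smul, smul_eq_mul] at h1 h2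
    rw [map_zero] at h1
    have h3 : f w = 0 := by linarith
    obtain ⟨g, hg⟩ := exists_vec (f : (Fin d → ℝ) →ₗ[ℝ] ℝ)
    obtain ⟨μ, hμ, rfl⟩ := h.normal (g := g) (fun w' hw' => by
      rw [← hg]
      have := hle w' (subset_convexHull ℝ _ hw')
      rw [map_smul, h3, smul_zero] at this
      exact this)
    have h4 := hg w
    have h4' : f w = (μ • b) ⬝ᵥ w := h4
    rw [h3, smul_dotProduct, smul_eq_mul] at h4'
    have hμ0 : μ = 0 := by
      rcases mul_eq_zero.1 h4'.symm with h | h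
      · exact h
      · exact absurd h hw.2
    obtain ⟨a, ha⟩ := h.hK
    have h5 := hf a ha
    have h6 : ∀ x, f x = 0 := fun x => by
      have : f x = (μ • b) ⬝ᵥ x := hg x
      rw [this, hμ0]; simp
    rw [h6, h6] at h5
    exact lt_irrefl _ h5
  have p3 : (0 : Fin d → ℝ) ∉ interior (convexHull ℝ (W : Set (Fin d → ℝ))) := by
    intro h0
    obtain ⟨r, hr, hball⟩ := Metric.isOpen_iff.1 (isOpen_interior.preimage
      (show Continuous (fun t : ℝ => t • b) by fun_prop)) 0 (by simpa using h0)
    have h1 := hball (show r / 2 ∈ Metric.ball (0 : ℝ) r by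
      rw [Metric.mem_ball, dist_zero_right, Real.norm_eq_abs, abs_of_pos (by linarith)]; linarith)
    have h2 := dot_conv_le h.hb (interior_subset h1)
    rw [dotProduct_smul, smul_eq_mul] at h2
    have h3 : 0 < b ⬝ᵥ b := by
      have := dotProduct_self_eq_zero (v := b)
      rcases lt_or_eq_of_le (show 0 ≤ b ⬝ᵥ b from
        Finset.sum_nonneg fun i _ => mul_self_nonneg _) with h' | h'
      · exact h'
      · exact absurd (this.1 h'.symm) h.hb0
    have := mul_pos (half_pos hr) h3
    linarith
  obtain ⟨hh, e1, e2, e3, e4, e5⟩ := upper_abstract hd h.H h.hK _ _ hdis hWu p1 p2 p3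
  · intro i hi
    rw [e1]
    refine Finset.sum_le_sum fun k hk => Nat.mul_le_mul_left _ ?_
    rw [hs, hcn] at e5
    rw [hq] at e4
    exact numeric e2 e3 e4 e5 k (by rw [mem_range] at hk; omega)

end core


section pside

variable {d : ℕ}

lemma dotp_eq (x y : Fin d → ℝ) : dotp x y = x ⬝ᵥ y := rfl

lemma face_hull (V : Finset (Fin d → ℝ)) {b : Fin d → ℝ} {c : ℝ} (h : ∀ v ∈ V, b ⬝ᵥ v ≤ c) :
    {x ∈ convexHull ℝ (V : Set (Fin d → ℝ)) | b ⬝ᵥ x = c} =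
      convexHull ℝ (({v ∈ V | b ⬝ᵥ v = c} : Finset (Fin d → ℝ)) : Set (Fin d → ℝ)) := by
  ext x
  constructor
  · rintro ⟨hx, hbx⟩
    rw [Finset.mem_convexHull'] at hx ⊢
    obtain ⟨w, h0, h1, rfl⟩ := hx
    have hz : ∑ v ∈ V, w v * (c - b ⬝ᵥ v) = 0 := by
      have : ∑ v ∈ V, w v * (c - b ⬝ᵥ v) = (∑ v ∈ V, w v) * c - ∑ v ∈ V, w v * (b ⬝ᵥ v) := by
        rw [Finset.sum_mul, ← Finset.sum_sub_distrib]
        exact Finset.sum_congr rfl fun v _ => by ring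
      rw [this, h1]
      rw [dotProduct_sum] at hbx
      simp only [dotProduct_smul, smul_eq_mul] at hbx
      rw [hbx]; ring
    have hz' := (Finset.sum_eq_zero_iff_of_nonneg
      (fun v hv => mul_nonneg (h0 v hv) (by linarith [h v hv]))).1 hz
    have hw : ∀ v ∈ V, v ∉ ({v ∈ V | b ⬝ᵥ v = c} : Finset (Fin d → ℝ)) → w v = 0 := by
      intro v hv hn
      rcases mul_eq_zero.1 (hz' v hv) with h' | h'
      · exact h'
      · exact absurd (by simp only [mem_filter, hv, true_and]; linarith) hn
    refine ⟨w, fun v hv => h0 v (mem_filter.1 hv).1, ?_, ?_⟩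
    · rw [← h1]; exact Finset.sum_subset (Finset.filter_subset _ _) hw
    · refine Finset.sum_subset (Finset.filter_subset _ _) fun v hv hn => ?_
      rw [hw v hv hn, zero_smul]
  · intro hx
    refine ⟨convexHull_mono (by exact_mod_cast Finset.filter_subset _ _) hx, ?_⟩
    refine le_antisymm (dot_conv_le (fun v hv => (mem_filter.1 hv).2.le) hx) ?_
    have := dot_conv_le (b := -b) (c := -c) (fun v hv => by
      rw [neg_dotProduct, (mem_filter.1 hv).2]) hx
    rw [neg_dotProduct] at this
    linarith

lemma polyDim_conv (S : Set (Fin d → ℝ)) :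
    polyDim (convexHull ℝ S) = Module.finrank ℝ (vectorSpan ℝ S) := by
  unfold polyDim
  rw [affineSpan_convexHull, direction_affineSpan]

lemma vs_translate (U : Set (Fin d → ℝ)) (x0 : Fin d → ℝ) :
    vectorSpan ℝ ((fun v => v - x0) '' U) = vectorSpan ℝ U := by
  rw [← vectorSpan_vadd ℝ U (-x0)]
  congr 1
  ext x
  simp only [Set.mem_image, Set.mem_vadd_set, vadd_eq_add, sub_eq_neg_add]

lemma vs_le_span (U : Set (Fin d → ℝ)) : vectorSpan ℝ U ≤ Submodule.span ℝ U := by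
  rw [vectorSpan_def]
  refine Submodule.span_le.2 ?_
  rintro _ ⟨x, hx, y, hy, rfl⟩
  exact Submodule.sub_mem _ (Submodule.subset_span hx) (Submodule.subset_span hy)

lemma finrank_vs {S : Set (Fin d → ℝ)} (hS : S.Nonempty) {y : Fin d → ℝ}
    (hy : ∀ s ∈ S, y ⬝ᵥ s = 1) :
    Module.finrank ℝ (vectorSpan ℝ S) + 1 = Module.finrank ℝ (Submodule.span ℝ S) := by
  obtain ⟨t, ht⟩ := hS
  have h0 : ∀ x ∈ vectorSpan ℝ S, y ⬝ᵥ x = 0 := by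
    intro x hx
    rw [vectorSpan_def] at hx
    refine dot_zero_span ?_ hx
    rintro _ ⟨a, ha, b, hb, rfl⟩
    simp only [vsub_eq_sub]
    rw [dotProduct_sub, hy a ha, hy b hb, sub_self]
  have ht0 : t ≠ 0 := by
    rintro rfl
    have := hy 0 ht
    simp at this
  have e1 : Submodule.span ℝ S = vectorSpan ℝ S ⊔ Submodule.span ℝ {t} := by
    refine le_antisymm (Submodule.span_le.2 fun s hs => ?_)
      (sup_le (vs_le_span S) (Submodule.span_mono (by simpa using ht)))
    have : s = (s - t) + t := by abel
    rw [SetLike.mem_coe, this]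
    refine Submodule.add_mem_sup ?_ (Submodule.mem_span_singleton_self t)
    exact vsub_mem_vectorSpan ℝ hs ht
  have e2 : vectorSpan ℝ S ⊓ Submodule.span ℝ {t} = ⊥ := by
    rw [eq_bot_iff]
    rintro x ⟨h1, h2⟩
    obtain ⟨a, rfl⟩ := Submodule.mem_span_singleton.1 h2
    have := h0 _ h1
    rw [dotProduct_smul, hy t ht, smul_eq_mul, mul_one] at this
    simp [this]
  have := Submodule.finrank_sup_add_finrank_inf_eq (vectorSpan ℝ S) (Submodule.span ℝ {t})
  rw [e2, ← e1, finrank_span_singleton ht0, finrank_bot] at this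
  omega

lemma verts_face {P : Set (Fin d → ℝ)} {b : Fin d → ℝ} {c : ℝ} (h : ∀ x ∈ P, b ⬝ᵥ x ≤ c) :
    verts {x ∈ P | b ⬝ᵥ x = c} = {x ∈ verts P | b ⬝ᵥ x = c} := by
  have : IsExtreme ℝ P {x ∈ P | b ⬝ᵥ x = c} := by
    refine ⟨fun x hx => hx.1, ?_⟩
    rintro x hx y hy z ⟨hz, hbz⟩ ⟨α, β, hα, hβ, hαβ, rfl⟩
    refine ⟨hx, ?_⟩
    rw [dotProduct_add, dotProduct_smul, dotProduct_smul, smul_eq_mul, smul_eq_mul] at hbz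
    have h1 := h x hx
    have h2 := h y hy
    by_contra hne
    have h3 : b ⬝ᵥ x < c := lt_of_le_of_ne h1 hne
    have : α * (b ⬝ᵥ x) + β * (b ⬝ᵥ y) < α * c + β * c :=
      add_lt_add_of_lt_of_le (mul_lt_mul_of_pos_left h3 hα) (mul_le_mul_of_nonneg_left h2 hβ.le)
    rw [← add_mul, hαβ, one_mul] at this
    linarith
  unfold verts
  rw [this.extremePoints_eq]
  ext x
  constructor
  · rintro ⟨h1, h2⟩; exact ⟨h2, h1.2⟩
  · rintro ⟨h1, h2⟩; exact ⟨⟨h1.1, h2⟩, h1⟩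

lemma poly_verts {P : Set (Fin d → ℝ)} (h : IsPolytope P) :
    ∃ V : Finset (Fin d → ℝ), (V : Set (Fin d → ℝ)) = verts P ∧
      P = convexHull ℝ (V : Set (Fin d → ℝ)) := by
  obtain ⟨V0, rfl⟩ := h
  have hfin : (verts (convexHull ℝ (V0 : Set (Fin d → ℝ)))).Finite :=
    V0.finite_toSet.subset extremePoints_convexHull_subset
  refine ⟨hfin.toFinset, by simp, ?_⟩
  have := closure_convexHull_extremePoints (V0.finite_toSet.isCompact_convexHull ℝ)
    (convex_convexHull ℝ _)
  change closure (convexHull ℝ (verts _)) = _ at this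
  rw [(hfin.isClosed_convexHull ℝ).closure_eq] at this
  rw [hfin.coe_toFinset]
  exact this.symm

theorem pside (hd : 2 ≤ d) {n s : ℕ} (hn : d + s < n) {P : Set (Fin d → ℝ)}
    (hP : MemASP d n s P) (i : ℕ) (hi1 : 1 ≤ i) (hid : i ≤ d) :
    fVec P (i - 1) ≤ ∑ k ∈ range (i + 1), (d - k).choose (i - k) * Bc d s (n - d - s) k +
      if i = d then 1 else 0 := by
  classical
  obtain ⟨hcard, F, ⟨hpoly, hdimP, ⟨hFface, hFne, hFdim⟩, hsimp⟩, hFcard⟩ := hP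
  obtain ⟨V, hV, hPV⟩ := poly_verts hpoly
  rw [← hV, Set.ncard_coe_finset] at hcard
  obtain ⟨b, c, hb0, hbc, hF⟩ : ∃ (b : Fin d → ℝ) (c : ℝ), b ≠ 0 ∧ (∀ x ∈ P, b ⬝ᵥ x ≤ c) ∧
      F = {x ∈ P | b ⬝ᵥ x = c} := by
    rcases hFface with h | h | h
    · exact absurd hFne (by simp [h])
    · rw [h, hdimP] at hFdim; omega
    · exact h
  have hVP : ∀ v ∈ V, v ∈ P := fun v hv => by rw [hPV]; exact subset_convexHull ℝ _ hv
  have hbV : ∀ v ∈ V, b ⬝ᵥ v ≤ c := fun v hv => hbc v (hVP v hv)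
  set Vf : Finset (Fin d → ℝ) := {v ∈ V | b ⬝ᵥ v = c} with hVf
  have hFV : F = convexHull ℝ (Vf : Set (Fin d → ℝ)) := by
    rw [hF, hPV, face_hull V hbV]
  have hVfc : Vf.card = d + s := by
    rw [← hFcard, hF, verts_face hbc, ← hV, ← Set.ncard_coe_finset]
    congr 1
    ext v; simp [hVf]
  obtain ⟨m, hm⟩ : ∃ m : ℕ, m = Vf.card := ⟨_, rfl⟩
  have hm0 : (0 : ℝ) < m := by
    have : 0 < m := by omega
    exact_mod_cast this
  set x0 : Fin d → ℝ := (1 / m : ℝ) • ∑ v ∈ Vf, v with hx0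
  have hx0sum : ∑ v ∈ Vf, v = (m : ℝ) • x0 := by
    rw [hx0, smul_smul, mul_one_div_cancel hm0.ne', one_smul]
  have hx0F : x0 ∈ F := by
    rw [hFV, hx0, Finset.smul_sum]
    refine (convex_convexHull ℝ _).sum_mem (fun _ _ => (one_div_pos.2 hm0).le) ?_
      (fun v hv => subset_convexHull ℝ _ hv)
    rw [Finset.sum_const, ← hm, nsmul_eq_mul, mul_one_div_cancel hm0.ne']
  have hbx0 : b ⬝ᵥ x0 = c := by rw [hF] at hx0F; exact hx0F.2
  have hx0P : x0 ∈ P := by rw [hF] at hx0F; exact hx0F.1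
  have hinj : Function.Injective (fun v : Fin d → ℝ => v - x0) := sub_left_injective
  set W : Finset (Fin d → ℝ) := V.image (fun v => v - x0) with hW
  have hWc : W.card = n := by rw [hW, Finset.card_image_of_injective _ hinj, hcard]
  have hfil : {w ∈ W | b ⬝ᵥ w = 0} = Vf.image (fun v => v - x0) := by
    rw [hW, Finset.filter_image]
    congr 1
    ext v
    simp only [hVf, mem_filter, dotProduct_sub, hbx0, sub_eq_zero]
  have hfil' : ({w ∈ W | b ⬝ᵥ w = 0} : Set (Fin d → ℝ)) =
      (fun v => v - x0) '' (Vf : Set (Fin d → ℝ)) := by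
    rw [← Finset.coe_image, ← hfil]
    ext w; simp
  have htight : ∀ y : Fin d → ℝ, tightS W y =
      ({v ∈ V | y ⬝ᵥ v = 1 + y ⬝ᵥ x0} : Finset (Fin d → ℝ)).image (fun v => v - x0) := by
    intro y
    unfold tightS
    rw [hW, Finset.filter_image]
    congr 1
    ext v
    simp only [mem_filter, dotProduct_sub, sub_eq_iff_eq_add]
  have hPolV : ∀ y : Fin d → ℝ, Pol W y → ∀ v ∈ V, y ⬝ᵥ v ≤ 1 + y ⬝ᵥ x0 := by
    intro y hy v hv
    have := hy (v - x0) (by rw [hW]; exact Finset.mem_image_of_mem _ hv)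
    rw [dotProduct_sub] at this
    linarith
  have hvsV : vectorSpan ℝ (V : Set (Fin d → ℝ)) = ⊤ := by
    rw [hPV, polyDim_conv] at hdimP
    apply Submodule.eq_top_of_finrank_eq
    simpa using hdimP
  have hVne : (V : Set (Fin d → ℝ)).Nonempty := by
    have : 0 < V.card := by omega
    exact_mod_cast Finset.card_pos.1 this
  have hS : Setup d W b := by
    refine ⟨?_, hb0, ?_, ?_, ?_, ?_, ?_⟩
    · rw [interior_convexHull_nonempty_iff_affineSpan_eq_top,
        AffineSubspace.affineSpan_eq_top_iff_vectorSpan_eq_top_of_nonempty, hW, Finset.coe_image,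
        vs_translate, hvsV]
      rw [hW, Finset.coe_image]
      exact hVne.image _
    · intro w hw
      obtain ⟨v, hv, rfl⟩ := Finset.mem_image.1 hw
      rw [dotProduct_sub, hbx0]
      linarith [hbV v hv]
    · rw [hfil, Finset.sum_image (fun _ _ _ _ h => hinj h), Finset.sum_sub_distrib, hx0sum,
        Finset.sum_const, ← hm, Nat.cast_smul_eq_nsmul, sub_self]
    · have : 0 < Vf.card := by omega
      obtain ⟨v, hv⟩ := Finset.card_pos.1 this
      have : v - x0 ∈ ({w ∈ W | b ⬝ᵥ w = 0} : Finset (Fin d → ℝ)) := by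
        rw [hfil]; exact Finset.mem_image_of_mem _ hv
      exact ⟨v - x0, (mem_filter.1 this).1, (mem_filter.1 this).2⟩
    · rw [hfil']
      rw [hFV, polyDim_conv, ← vs_translate _ x0] at hFdim
      rw [← hFdim]
      exact Submodule.finrank_mono (vs_le_span _)
    · intro y hy hspan
      have hyV := hPolV y hy
      have hyP : ∀ x ∈ P, y ⬝ᵥ x ≤ 1 + y ⬝ᵥ x0 := fun x hx => by
        rw [hPV] at hx; exact dot_conv_le hyV hx
      have hne : (tightS W y : Set (Fin d → ℝ)).Nonempty := by
        rw [Set.nonempty_iff_ne_empty]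
        intro he
        rw [he, Submodule.span_empty] at hspan
        have h1 := congrArg (fun U : Submodule ℝ (Fin d → ℝ) => Module.finrank ℝ U) hspan
        simp at h1
        omega
      have hG : {x ∈ P | y ⬝ᵥ x = 1 + y ⬝ᵥ x0} = convexHull ℝ
          (({v ∈ V | y ⬝ᵥ v = 1 + y ⬝ᵥ x0} : Finset (Fin d → ℝ)) : Set (Fin d → ℝ)) := by
        rw [hPV, face_hull V hyV]
      have hne' : (({v ∈ V | y ⬝ᵥ v = 1 + y ⬝ᵥ x0} : Finset (Fin d → ℝ)) :
          Set (Fin d → ℝ)).Nonempty := by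
        rw [htight, Finset.coe_image] at hne
        exact Set.image_nonempty.1 hne
      have hy0 : y ≠ 0 := by
        rintro rfl
        obtain ⟨t, ht⟩ := hne
        have := (mem_tightS.1 (Finset.mem_coe.1 ht)).2
        simp at this
      have hv := hsimp {x ∈ P | y ⬝ᵥ x = 1 + y ⬝ᵥ x0} ?_ ?_
      · rw [htight, Finset.card_image_of_injective _ hinj]
        rw [verts_face hyP, ← hV] at hv
        refine Eq.trans ?_ hv
        rw [← Set.ncard_coe_finset]
        congr 1
        ext v; simp
      · refine ⟨Or.inr (Or.inr ⟨y, _, hy0, hyP, rfl⟩), ?_, ?_⟩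
        · rw [hG]; exact hne'.mono (subset_convexHull ℝ _)
        · have h1 := finrank_vs hne (y := y) (fun t ht => (mem_tightS.1 (Finset.mem_coe.1 ht)).2)
          rw [hspan, htight, Finset.coe_image, vs_translate] at h1
          rw [hG, polyDim_conv]
          rw [finrank_top, Module.finrank_fintype_fun_eq_card, Fintype.card_fin] at h1
          omega
      · intro he
        rw [← he] at hx0F
        have := hx0F.2
        linarith
  have hWf : #{w ∈ W | b ⬝ᵥ w = 0} = d + s := by
    rw [hfil, Finset.card_image_of_injective _ hinj, hVfc]
  have hbound := hS.bound (by omega) hWf (q := n - d - s) (by omega) i hid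
  refine le_trans ?_ (Nat.add_le_add_right hbound _)
  unfold fVec
  have hsub : {G : Set (Fin d → ℝ) | IsFaceOf P G ∧ G.Nonempty ∧ polyDim G = i - 1} ⊆
      (fun S : Finset (Fin d → ℝ) => convexHull ℝ ((fun v => v + x0) '' (S : Set (Fin d → ℝ)))) ''
        ({S ∈ facesW W | S.card = i} : Finset (Finset (Fin d → ℝ))) ∪
      (if i = d then {F} else ∅) := by
    rintro G ⟨hGf, hGne, hGdim⟩
    rcases hGf with h | h | ⟨b', c', hb', hbc', hG⟩
    · exact absurd hGne (by simp [h])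
    · rw [h, hdimP] at hGdim; omega
    · simp only [dotp_eq] at hbc' hG
      have hγ : b' ⬝ᵥ x0 ≤ c' := hbc' x0 hx0P
      rcases eq_or_lt_of_le hγ with hγ | hγ
      · right
        obtain ⟨μ, hμ, hμb⟩ := hS.normal (g := b') (fun w hw => by
          obtain ⟨v, hv, rfl⟩ := Finset.mem_image.1 hw
          rw [dotProduct_sub, hγ]
          linarith [hbc' v (hVP v hv)])
        have hμ0 : μ ≠ 0 := by rintro rfl; simp at hμb; exact hb' hμb
        have hGF : G = F := by
          rw [hG, hF]
          ext x
          simp only [Set.mem_ofPred_eq]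
          refine and_congr_right fun _ => ?_
          rw [← hγ, ← hbx0, hμb, smul_dotProduct, smul_dotProduct, smul_eq_mul, smul_eq_mul]
          constructor
          · exact fun h => mul_left_cancel₀ hμ0 h
          · exact fun h => by rw [h]
        have : i = d := by rw [hGF, hFdim] at hGdim; omega
        rw [if_pos this, hGF]; rfl
      · left
        set γ := c' - b' ⬝ᵥ x0 with hγd
        have hγ0 : 0 < γ := by rw [hγd]; linarith
        set y : Fin d → ℝ := γ⁻¹ • b' with hy
        have hyx : ∀ x, y ⬝ᵥ x = γ⁻¹ * (b' ⬝ᵥ x) := fun x => by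
          rw [hy, smul_dotProduct, smul_eq_mul]
        have hPol : Pol W y := by
          intro w hw
          obtain ⟨v, hv, rfl⟩ := Finset.mem_image.1 hw
          rw [hyx, inv_mul_le_iff₀ hγ0, dotProduct_sub]
          linarith [hbc' v (hVP v hv)]
        have heq : ∀ x, b' ⬝ᵥ x = c' ↔ y ⬝ᵥ x = 1 + y ⬝ᵥ x0 := by
          intro x
          rw [hyx, hyx, ← sub_eq_iff_eq_add, ← mul_sub, inv_mul_eq_iff_eq_mul₀ hγ0.ne', mul_one,
            sub_eq_iff_eq_add, hγd, sub_add_cancel]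
        have hG2 : G = convexHull ℝ
            (({v ∈ V | y ⬝ᵥ v = 1 + y ⬝ᵥ x0} : Finset (Fin d → ℝ)) : Set (Fin d → ℝ)) := by
          rw [← face_hull V (hPolV y hPol), ← hPV, hG]
          ext x
          simp only [Set.mem_ofPred_eq, heq]
        have hne' : (({v ∈ V | y ⬝ᵥ v = 1 + y ⬝ᵥ x0} : Finset (Fin d → ℝ)) :
            Set (Fin d → ℝ)).Nonempty := by
          rw [hG2] at hGne
          exact convexHull_nonempty_iff.1 hGne
        have hIsF : IsF W (tightS W y) := ⟨y, hPol, rfl⟩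
        refine ⟨tightS W y, ?_, ?_⟩
        · simp only [coe_filter, Set.mem_ofPred_eq]
          refine ⟨mem_facesW.2 hIsF, ?_⟩
          have hne : (tightS W y : Set (Fin d → ℝ)).Nonempty := by
            rw [htight, Finset.coe_image]; exact hne'.image _
          have h1 := finrank_vs hne (y := y) (fun t ht => (mem_tightS.1 (Finset.mem_coe.1 ht)).2)
          rw [finrank_span_finset_eq_card (hS.H _ hIsF)] at h1
          rw [← h1]
          have h2 : vectorSpan ℝ (tightS W y : Set (Fin d → ℝ)) = vectorSpan ℝ
              (({v ∈ V | y ⬝ᵥ v = 1 + y ⬝ᵥ x0} : Finset (Fin d → ℝ)) : Set (Fin d → ℝ)) := by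
            rw [htight, Finset.coe_image, vs_translate]
          rw [h2, ← polyDim_conv, ← hG2, hGdim]
          omega
        · simp only
          rw [hG2, htight, Finset.coe_image, Set.image_image]
          simp
  refine (Set.ncard_le_ncard hsub ?_).trans ((Set.ncard_union_le _ _).trans (add_le_add ?_ ?_))
  · refine Set.Finite.union ((Finset.finite_toSet _).image _) ?_
    split_ifs
    · exact Set.finite_singleton _
    · exact Set.finite_empty
  · refine (Set.ncard_image_le (Finset.finite_toSet _)).trans ?_
    rw [Set.ncard_coe_finset]
  · split_ifs <;> simp

end pside


section cgeom

open Polynomial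

lemma alt_bound (x : ℕ → ℝ) (U : Finset ℕ) : (∀ i ∈ U, 0 ≤ x i) →
    (∀ i ∈ U, ∀ j ∈ U, i < j → x i ≤ x j) → ∀ c, 0 ≤ c → (∀ i ∈ U, x i ≤ c) →
    0 ≤ ∑ i ∈ U, (-1 : ℝ) ^ #{l ∈ U | i < l} * x i ∧
      ∑ i ∈ U, (-1 : ℝ) ^ #{l ∈ U | i < l} * x i ≤ c := by
  induction U using Finset.induction_on_max with
  | empty => intro _ _ c hc _; simp [hc]
  | insert a U ha ih =>
    intro h0 hm c hc hxc
    have haU : a ∉ U := fun h => lt_irrefl _ (ha a h)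
    have e : ∑ i ∈ insert a U, (-1 : ℝ) ^ #{l ∈ insert a U | i < l} * x i =
        x a - ∑ i ∈ U, (-1 : ℝ) ^ #{l ∈ U | i < l} * x i := by
      rw [Finset.sum_insert haU, sub_eq_add_neg, ← Finset.sum_neg_distrib]
      congr 1
      · have : ({l ∈ insert a U | a < l} : Finset ℕ) = ∅ := by
          rw [Finset.filter_eq_empty_iff]
          intro l hl
          rcases Finset.mem_insert.1 hl with rfl | hl
          · exact lt_irrefl _
          · exact not_lt.2 (ha l hl).le
        rw [this]; simp
      · refine Finset.sum_congr rfl fun i hi => ?_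
        rw [Finset.filter_insert, if_pos (ha i hi), Finset.card_insert_of_notMem, pow_succ]
        · ring
        · simp [haU]
    rw [e]
    obtain ⟨h1, h2⟩ := ih (fun i hi => h0 i (Finset.mem_insert_of_mem hi))
      (fun i hi j hj hij => hm i (Finset.mem_insert_of_mem hi) j (Finset.mem_insert_of_mem hj) hij)
      (x a) (h0 a (Finset.mem_insert_self _ _))
      (fun i hi => hm i (Finset.mem_insert_of_mem hi) a (Finset.mem_insert_self _ _) (ha i hi))
    have h3 := hxc a (Finset.mem_insert_self _ _)
    constructor <;> linarith

/-- positivity of the alternating sum. -/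
lemma alt_pos (x : ℕ → ℝ) (U : Finset ℕ) (h0 : ∀ i ∈ U, 0 ≤ x i)
    (hm : ∀ i ∈ U, ∀ j ∈ U, i < j → 0 < x j → x i < x j)
    (hm' : ∀ i ∈ U, ∀ j ∈ U, i < j → x i ≤ x j)
    (hpos : ∃ i ∈ U, 0 < x i) :
    0 < ∑ i ∈ U, (-1 : ℝ) ^ #{l ∈ U | i < l} * x i := by
  induction U using Finset.induction_on_max with
  | empty => simp at hpos
  | insert a U ha _ =>
    have haU : a ∉ U := fun h => lt_irrefl _ (ha a h)
    have e : ∑ i ∈ insert a U, (-1 : ℝ) ^ #{l ∈ insert a U | i < l} * x i =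
        x a - ∑ i ∈ U, (-1 : ℝ) ^ #{l ∈ U | i < l} * x i := by
      rw [Finset.sum_insert haU, sub_eq_add_neg, ← Finset.sum_neg_distrib]
      congr 1
      · have : ({l ∈ insert a U | a < l} : Finset ℕ) = ∅ := by
          rw [Finset.filter_eq_empty_iff]
          intro l hl
          rcases Finset.mem_insert.1 hl with rfl | hl
          · exact lt_irrefl _
          · exact not_lt.2 (ha l hl).le
        rw [this]; simp
      · refine Finset.sum_congr rfl fun i hi => ?_
        rw [Finset.filter_insert, if_pos (ha i hi), Finset.card_insert_of_notMem, pow_succ]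
        · ring
        · simp [haU]
    have hxa : 0 < x a := by
      obtain ⟨i, hi, hxi⟩ := hpos
      rcases Finset.mem_insert.1 hi with rfl | hi'
      · exact hxi
      · exact hxi.trans_le (hm' i hi a (Finset.mem_insert_self _ _) (ha i hi'))
    rw [e]
    rcases U.eq_empty_or_nonempty with rfl | hne
    · simpa using hxa
    · obtain ⟨m, hmU, hmax⟩ := Finset.exists_max_image U x hne
      have := (alt_bound x U (fun i hi => h0 i (Finset.mem_insert_of_mem hi))
        (fun i hi j hj hij => hm' i (Finset.mem_insert_of_mem hi) j
          (Finset.mem_insert_of_mem hj) hij) (x m) (h0 m (Finset.mem_insert_of_mem hmU)) hmax).2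
      have h2 := hm m (Finset.mem_insert_of_mem hmU) a (Finset.mem_insert_self _ _) (ha m hmU) hxa
      linarith

lemma prod_sign (A : Finset ℕ) (i : ℕ) :
    ∏ l ∈ A, ((i : ℝ) - l) = (-1 : ℝ) ^ #{l ∈ A | i < l} * ∏ l ∈ A, |(i : ℝ) - l| := by
  have : ∀ l ∈ A, ((i : ℝ) - l) = (if i < l then -1 else 1) * |(i : ℝ) - l| := by
    intro l _
    split_ifs with h
    · have : (i : ℝ) < l := by exact_mod_cast h
      rw [abs_of_neg (by linarith)]; ring
    · have : (l : ℝ) ≤ i := by exact_mod_cast not_lt.1 h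
      rw [abs_of_nonneg (by linarith)]; ring
  rw [Finset.prod_congr rfl this, Finset.prod_mul_distrib, Finset.prod_ite]
  simp

/-- interpolation inequality -/
lemma interp_lt (n D : ℕ) (p : ℕ → ℝ) (hp0 : ∀ i < n, 0 ≤ p i)
    (hp : ∀ i j, i < j → j < n → 0 < p j → ((n : ℝ) - 1) ^ (D - 1) * p i < p j)
    (hp' : ∀ i j, i < j → j < n → p j = 0 → p i = 0)
    (c : ℝ) (T : Finset ℕ) (hT : T ⊆ range n) (hTD : T.card = D)
    (hpos : ∃ i ∈ T, 0 < p i) (w : ℕ) (hw : w < n) (hwT : w ∉ T)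
    (σ : ℝ) (hev : (-1 : ℝ) ^ #{l ∈ T | w < l} = σ) :
    σ * (Lagrange.interpolate T (fun j => (j : ℝ) + c) p).eval ((w : ℝ) + c) < σ * p w := by
  have hσ : σ * σ = 1 := by rw [← hev, ← mul_pow]; norm_num
  set U := insert w T with hU
  have hUn : ∀ i ∈ U, i < n := by
    intro i hi
    rcases Finset.mem_insert.1 hi with rfl | hi
    · exact hw
    · exact mem_range.1 (hT hi)
  have hUc : U.card = D + 1 := by rw [hU, Finset.card_insert_of_notMem hwT, hTD]
  have hn1 : (0 : ℝ) ≤ (n : ℝ) - 1 := by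
    have : 1 ≤ n := by omega
    have : (1 : ℝ) ≤ n := by exact_mod_cast this
    linarith
  set Q : ℕ → ℝ := fun i => ∏ l ∈ U.erase i, |(i : ℝ) - l| with hQ
  have hQpos : ∀ i, 0 < Q i := by
    intro i
    refine Finset.prod_pos fun l hl => abs_pos.2 ?_
    have := (Finset.mem_erase.1 hl).1
    rw [sub_ne_zero]; exact_mod_cast this.symm
  set x : ℕ → ℝ := fun i => p i * (Q i)⁻¹ with hx
  have hmono : ∀ i ∈ U, ∀ j ∈ U, i < j → 0 < p j → x i < x j := by
    intro i hi j hj hij hpj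
    have hR1 : ∀ a ∈ U, ∀ b ∈ U, a ≠ b →
        Q a = |(a : ℝ) - b| * ∏ l ∈ (U.erase a).erase b, |(a : ℝ) - l| := by
      intro a ha b hb hab
      exact (Finset.mul_prod_erase _ _ (Finset.mem_erase.2 ⟨hab.symm, hb⟩)).symm
    have hi1 := hR1 i hi j hj hij.ne
    have hj1 := hR1 j hj i hi hij.ne'
    rw [Finset.erase_right_comm] at hj1
    set R := (U.erase i).erase j with hR
    have hRc : R.card = D - 1 := by
      rw [hR, Finset.card_erase_of_mem (Finset.mem_erase.2 ⟨hij.ne', hj⟩),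
        Finset.card_erase_of_mem hi, hUc]; omega
    have hge : 1 ≤ ∏ l ∈ R, |(i : ℝ) - l| := by
      refine Finset.one_le_prod fun l hl => ?_
      have h1 : l ≠ i := (Finset.mem_erase.1 (Finset.mem_of_mem_erase hl)).1
      have h2 : (1 : ℤ) ≤ |(i : ℤ) - l| := Int.one_le_abs (by omega)
      exact_mod_cast h2
    have hle : ∏ l ∈ R, |(j : ℝ) - l| ≤ ((n : ℝ) - 1) ^ (D - 1) := by
      rw [← hRc, ← Finset.prod_const]
      refine Finset.prod_le_prod (fun _ _ => abs_nonneg _) fun l hl => ?_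
      have h1 : l < n := hUn l (Finset.mem_of_mem_erase (Finset.mem_of_mem_erase hl))
      have h2 : j < n := hUn j hj
      have h3 : (l : ℝ) + 1 ≤ n := by exact_mod_cast h1
      have h4 : (j : ℝ) + 1 ≤ n := by exact_mod_cast h2
      have h5 : (0 : ℝ) ≤ l := Nat.cast_nonneg _
      have h6 : (0 : ℝ) ≤ j := Nat.cast_nonneg _
      rw [abs_le]; constructor <;> linarith
    have hδ : |(j : ℝ) - i| = |(i : ℝ) - j| := abs_sub_comm _ _
    have hδ0 : 0 < |(i : ℝ) - j| := abs_pos.2 (by rw [sub_ne_zero]; exact_mod_cast hij.ne)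
    have hgr := hp i j hij (hUn j hj) hpj
    have hpi := hp0 i (hUn i hi)
    show p i * (Q i)⁻¹ < p j * (Q j)⁻¹
    rw [← div_eq_mul_inv, ← div_eq_mul_inv, div_lt_div_iff₀ (hQpos i) (hQpos j), hi1, hj1, hδ]
    set δ := |(i : ℝ) - j|
    set A := ∏ l ∈ R, |(i : ℝ) - l|
    set B := ∏ l ∈ R, |(j : ℝ) - l|
    have h1 : p i * B < p j * A := by
      calc p i * B ≤ p i * ((n : ℝ) - 1) ^ (D - 1) := mul_le_mul_of_nonneg_left hle hpi
        _ = ((n : ℝ) - 1) ^ (D - 1) * p i := mul_comm _ _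
        _ < p j := hgr
        _ ≤ p j * A := le_mul_of_one_le_right hpj.le hge
    nlinarith
  have hDD : 0 < ∑ i ∈ U, (-1 : ℝ) ^ #{l ∈ U | i < l} * x i := by
    refine alt_pos x U ?_ ?_ ?_ ?_
    · exact fun i hi => mul_nonneg (hp0 i (hUn i hi)) (inv_nonneg.2 (hQpos i).le)
    · intro i hi j hj hij hxj
      exact hmono i hi j hj hij (by
        by_contra hc
        have : p j ≤ 0 := not_lt.1 hc
        have := mul_nonpos_of_nonpos_of_nonneg this (inv_nonneg.2 (hQpos j).le)
        have hxj' : 0 < p j * (Q j)⁻¹ := hxj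
        linarith)
    · intro i hi j hj hij
      rcases (hp0 j (hUn j hj)).eq_or_lt with h | h
      · have h2 := hp' i j hij (hUn j hj) h.symm
        show p i * (Q i)⁻¹ ≤ p j * (Q j)⁻¹
        rw [h2, ← h]; simp
      · exact (hmono i hi j hj hij h).le
    · obtain ⟨i, hi, hpi⟩ := hpos
      exact ⟨i, Finset.mem_insert_of_mem hi, mul_pos hpi (inv_pos.2 (hQpos i))⟩
  have hterm : ∀ i, (-1 : ℝ) ^ #{l ∈ U | i < l} * x i =
      p i * ∏ l ∈ U.erase i, ((i : ℝ) - l)⁻¹ := by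
    intro i
    rw [Finset.prod_inv_distrib, prod_sign]
    have : ({l ∈ U.erase i | i < l} : Finset ℕ) = {l ∈ U | i < l} := by
      ext l; simp only [mem_filter, mem_erase]
      constructor
      · exact fun h => ⟨h.1.2, h.2⟩
      · exact fun h => ⟨⟨h.2.ne', h.1⟩, h.2⟩
    rw [this, mul_inv]
    have h1 : ((-1 : ℝ) ^ #{l ∈ U | i < l})⁻¹ = (-1 : ℝ) ^ #{l ∈ U | i < l} := by
      rw [← inv_pow]; norm_num
    rw [h1]; simp only [hx, hQ]; ring
  rw [Finset.sum_congr rfl (fun i _ => hterm i), hU, Finset.sum_insert hwT,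
    Finset.erase_insert hwT] at hDD
  set N := ∏ l ∈ T, ((w : ℝ) - l) with hN
  have hNpos : 0 < σ * N := by
    rw [hN, prod_sign, hev, ← mul_assoc, hσ, one_mul]
    refine Finset.prod_pos fun l hl => abs_pos.2 ?_
    rw [sub_ne_zero]
    intro h
    have : w = l := by exact_mod_cast h
    exact hwT (this ▸ hl)
  rw [Lagrange.eval_interpolate_not_at_node]
  · rw [Lagrange.eval_nodal]
    have e1 : ∏ i ∈ T, ((w : ℝ) + c - ((i : ℝ) + c)) = N :=
      Finset.prod_congr rfl fun i _ => by ring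
    rw [e1]
    have e2 : ∑ i ∈ T, Lagrange.nodalWeight T (fun j => (j : ℝ) + c) i *
        ((w : ℝ) + c - ((i : ℝ) + c))⁻¹ * p i =
        - ∑ i ∈ T, p i * ∏ l ∈ (insert w T).erase i, ((i : ℝ) - l)⁻¹ := by
      rw [← Finset.sum_neg_distrib]
      refine Finset.sum_congr rfl fun i hi => ?_
      have hiw : i ≠ w := fun h => hwT (h ▸ hi)
      rw [Finset.erase_insert_of_ne hiw.symm, Finset.prod_insert (by simp [hwT])]
      unfold Lagrange.nodalWeight
      have e3 : ∏ j ∈ T.erase i, ((i : ℝ) + c - ((j : ℝ) + c))⁻¹ =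
          ∏ j ∈ T.erase i, ((i : ℝ) - j)⁻¹ :=
        Finset.prod_congr rfl fun j _ => by congr 1; ring
      rw [e3]
      have e4 : ((w : ℝ) + c - ((i : ℝ) + c))⁻¹ = - ((i : ℝ) - w)⁻¹ := by
        rw [← inv_neg]; congr 1; ring
      rw [e4]; ring
    rw [e2]
    rw [Finset.prod_inv_distrib, ← hN] at hDD
    have := mul_pos hNpos hDD
    have hN0 : N ≠ 0 := fun h => by rw [h, mul_zero] at hNpos; exact lt_irrefl _ hNpos
    rw [mul_add, mul_assoc, mul_left_comm N, mul_inv_cancel₀ hN0, mul_one, mul_assoc] at this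
    linarith
  · intro i hi h
    have : (w : ℝ) = i := by linarith
    have : w = i := by exact_mod_cast this
    exact hwT (this ▸ hi)

end cgeom


section cfaces

open Polynomial

lemma acT_eq (d s j : ℕ) : acT d s j = (j : ℝ) + (1 - s - d) := by unfold acT; ring

/-- the value of `p` at the `j`-th node. -/
def pv (d n s j : ℕ) : ℝ := acp d n s (acT d s j)

/-- the `j`-th point. -/
def pt (d n s j : ℕ) : Fin d → ℝ := acy d n s (acT d s j)

lemma pv_zero {d n s j : ℕ} (h : j < d + s) : pv d n s j = 0 := by
  unfold pv acp
  refine mul_eq_zero_of_right _ (Finset.prod_eq_zero (i := d + s - 1 - j) ?_ ?_)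
  · rw [mem_range]; omega
  · have : ((d + s - 1 - j : ℕ) : ℝ) = (d : ℝ) + s - 1 - j := by
      rw [Nat.cast_sub (by omega), Nat.cast_sub (by omega)]; push_cast; ring
    rw [this, acT]; ring

lemma acT_ge {d s j : ℕ} (h : d + s ≤ j) : 1 ≤ acT d s j := by
  have : (d : ℝ) + s ≤ j := by exact_mod_cast h
  unfold acT; linarith

lemma pv_pos {d n s j : ℕ} (hn : 2 ≤ n) (h : d + s ≤ j) : 0 < pv d n s j := by
  unfold pv acp
  have h1 := acT_ge h
  have h2 : (2 : ℝ) ≤ n := by exact_mod_cast hn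
  refine mul_pos (Real.rpow_pos_of_pos (by linarith) _) (Finset.prod_pos fun l _ => ?_)
  positivity

lemma pv_nonneg {d n s : ℕ} (hn : 2 ≤ n) (j : ℕ) : 0 ≤ pv d n s j := by
  rcases lt_or_ge j (d + s) with h | h
  · rw [pv_zero h]
  · exact (pv_pos hn h).le

lemma pv_growth {d n s i j : ℕ} (hd : 1 ≤ d) (hn : 2 ≤ n) (hij : i < j) (hj : 0 < pv d n s j) :
    ((n : ℝ) - 1) ^ (d - 1) * pv d n s i < pv d n s j := by
  rcases lt_or_ge i (d + s) with h | h
  · rw [pv_zero h, mul_zero]; exact hj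
  · have h1 := acT_ge h
    have h2 : (2 : ℝ) ≤ n := by exact_mod_cast hn
    have h3 : acT d s i + 1 ≤ acT d s j := by
      have : (i : ℝ) + 1 ≤ j := by exact_mod_cast hij
      unfold acT; linarith
    have hdr : ((d - 1 : ℕ) : ℝ) = (d : ℝ) - 1 := by rw [Nat.cast_sub hd]; simp
    have hd0 : (0 : ℝ) ≤ (d : ℝ) - 1 := by rw [← hdr]; exact Nat.cast_nonneg _
    unfold pv acp
    rw [← mul_assoc, ← Real.rpow_natCast, ← Real.rpow_add (by linarith), hdr]
    have e1 : ((n : ℝ) - 1) ^ ((d : ℝ) - 1 + (acT d s i - 1) * ((d : ℝ) - 1)) ≤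
        ((n : ℝ) - 1) ^ ((acT d s j - 1) * ((d : ℝ) - 1)) := by
      apply Real.rpow_le_rpow_of_exponent_le (by linarith)
      nlinarith
    have e2 : ∏ l ∈ range (d + s), (acT d s i + l) < ∏ l ∈ range (d + s), (acT d s j + l) := by
      refine Finset.prod_lt_prod_of_nonempty (fun l _ => by positivity)
        (fun l _ => by linarith) ?_
      rw [Finset.nonempty_range_iff]; omega
    have e3 : 0 < ((n : ℝ) - 1) ^ ((acT d s j - 1) * ((d : ℝ) - 1)) :=
      Real.rpow_pos_of_pos (by linarith) _
    have e4 : 0 ≤ ∏ l ∈ range (d + s), (acT d s i + l) :=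
      Finset.prod_nonneg fun l _ => by positivity
    calc _ ≤ ((n : ℝ) - 1) ^ ((acT d s j - 1) * ((d : ℝ) - 1)) *
          ∏ l ∈ range (d + s), (acT d s i + l) := mul_le_mul_of_nonneg_right e1 e4
      _ < _ := mul_lt_mul_of_pos_left e2 e3

lemma vec_poly {d : ℕ} (hd : 1 ≤ d) (n s : ℕ) (f : ℝ[X]) (hf : f.degree < d) (c : ℝ) :
    ∃ b : Fin d → ℝ, (∀ j, b ⬝ᵥ pt d n s j =
      c * pv d n s j + (f.eval (acT d s j) - f.coeff 0)) ∧ (b = 0 → c = 0) := by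
  obtain ⟨e, rfl⟩ : ∃ e, d = e + 1 := ⟨d - 1, by omega⟩
  refine ⟨fun i => if (i : ℕ) + 1 = e + 1 then c else f.coeff (i + 1), ?_, ?_⟩
  · intro j
    have hnd : f.natDegree < e + 1 := by
      by_cases h0 : f = 0
      · simp [h0]
      · exact (Polynomial.natDegree_lt_iff_degree_lt h0).2 hf
    rw [Polynomial.eval_eq_sum_range' hnd, Finset.sum_range_succ', Finset.sum_range]
    unfold dotProduct pt acy pv
    rw [Fin.sum_univ_castSucc]
    simp only [Fin.val_castSucc, Fin.val_last, if_true, pow_zero, mul_one, add_sub_cancel_right]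
    rw [add_comm]
    congr 1
    refine Finset.sum_congr rfl fun i _ => ?_
    have : (i : ℕ) + 1 ≠ e + 1 := by have := i.2; omega
    rw [if_neg this, if_neg this]
  · intro h
    have := congrFun h (Fin.last e)
    simpa using this

/-- `S` is the index set of a face cut out by a "lower" hyperplane. -/
def Facial (d n s : ℕ) (S : Finset ℕ) : Prop :=
  S ⊆ range n ∧ ∃ σ : ℝ, σ ≠ 0 ∧ ∃ f : ℝ[X], f.degree < d ∧
    ∀ j < n, f.eval (acT d s j) ≤ σ * pv d n s j ∧
    (f.eval (acT d s j) = σ * pv d n s j ↔ j ∈ S)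

lemma facial_F {d n s : ℕ} (hn : d + s < n) (hn2 : 2 ≤ n) : Facial d n s (range (d + s)) := by
  refine ⟨fun j hj => by rw [mem_range] at hj ⊢; omega, 1, one_ne_zero, 0, ?_, fun j hj => ?_⟩
  · rw [degree_zero]; exact WithBot.bot_lt_coe _
  · rw [eval_zero, mem_range, one_mul]
    refine ⟨pv_nonneg hn2 j, ?_⟩
    constructor
    · intro h
      by_contra hc
      have := pv_pos (d := d) (s := s) hn2 (not_lt.1 hc)
      linarith
    · exact fun h => (pv_zero h).symm

lemma facial_of {d n s : ℕ} (hd : 1 ≤ d) (hn2 : 2 ≤ n) {S T : Finset ℕ} (hST : S ⊆ T)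
    (hT : T ⊆ range n) (hc : T.card = d) (hpos : ∃ t ∈ T, d + s ≤ t)
    (e : ℕ) (hev : ∀ w < n, w ∉ T → #{t ∈ T | w < t} % 2 = e % 2) : Facial d n s S := by
  have hev : ∀ w < n, w ∉ T → (-1 : ℝ) ^ #{t ∈ T | w < t} = (-1) ^ e := fun w hw hwT => by
    rw [neg_one_pow_eq_pow_mod_two, hev w hw hwT, ← neg_one_pow_eq_pow_mod_two]
  have hσ0 : (-1 : ℝ) ^ e ≠ 0 := pow_ne_zero _ (by norm_num)
  set σ : ℝ := (-1) ^ e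
  refine ⟨hST.trans hT, σ, hσ0, ?_⟩
  set v : ℕ → ℝ := fun j => (j : ℝ) + (1 - s - d) with hv
  have hvinj : Set.InjOn v (T : Set ℕ) := by
    intro a _ b _ hab
    have : (a : ℝ) = b := by simp only [hv] at hab; linarith
    exact_mod_cast this
  set I := Lagrange.interpolate T v (pv d n s) with hI
  set h := Lagrange.interpolate T v (fun j => if j ∈ S then (0 : ℝ) else 1) with hh
  have hlt : ∀ w < n, w ∉ T → σ * I.eval (v w) < σ * pv d n s w := by
    intro w hw hwT
    refine interp_lt n d (pv d n s) (fun i _ => pv_nonneg hn2 i)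
      (fun i j hij _ hj => pv_growth hd hn2 hij hj) (fun i j hij _ hj => ?_) _ T hT hc ?_ w hw hwT σ
      (hev w hw hwT)
    · apply pv_zero
      by_contra hcon
      have := pv_pos (d := d) (s := s) (j := j) hn2 (by omega)
      linarith
    · obtain ⟨t, ht, h1⟩ := hpos
      exact ⟨t, ht, pv_pos hn2 h1⟩
  have key : ∀ᶠ ε in nhdsWithin (0 : ℝ) (Set.Ioi 0),
      ∀ w ∈ range n \ T, σ * I.eval (v w) - ε * h.eval (v w) < σ * pv d n s w := by
    rw [Filter.eventually_all_finset]
    intro w hw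
    rw [mem_sdiff, mem_range] at hw
    have hcont : Continuous (fun ε : ℝ => σ * I.eval (v w) - ε * h.eval (v w)) := by fun_prop
    have := hcont.tendsto 0
    have h2 := this.eventually_lt_const (show σ * I.eval (v w) - 0 * h.eval (v w) < σ * pv d n s w by
      simpa using hlt w hw.1 hw.2)
    exact h2.filter_mono nhdsWithin_le_nhds
  obtain ⟨ε, hε, hε0⟩ := (key.and self_mem_nhdsWithin).exists
  have hε0 : 0 < ε := hε0
  refine ⟨C σ * I - C ε * h, ?_, ?_⟩
  · refine (degree_sub_le _ _).trans_lt (max_lt ?_ ?_)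
    · refine lt_of_le_of_lt (degree_mul_le _ _) ?_
      rw [degree_C hσ0, zero_add, ← hc]
      exact Lagrange.degree_interpolate_lt _ hvinj
    · refine lt_of_le_of_lt (degree_mul_le _ _) ?_
      rw [degree_C hε0.ne', zero_add, ← hc]
      exact Lagrange.degree_interpolate_lt _ hvinj
  · intro j hj
    have e : acT d s j = v j := acT_eq d s j
    rw [e, eval_sub, eval_mul, eval_mul, eval_C, eval_C]
    by_cases hjT : j ∈ T
    · rw [hI, hh, Lagrange.eval_interpolate_at_node _ hvinj hjT,
        Lagrange.eval_interpolate_at_node _ hvinj hjT]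
      split_ifs with hS
      · simp [hS]
      · simp only [hS, iff_false, mul_one]
        constructor
        · linarith
        · intro h; linarith
    · have h1 := hε j (by simp [hj, hjT])
      refine ⟨h1.le, ?_⟩
      constructor
      · intro h2; linarith
      · intro h2; exact absurd (hST h2) hjT

lemma range_acPoint (d n s : ℕ) : Set.range (acPoint d n s) =
    (((range n).image (pt d n s) : Finset (Fin d → ℝ)) : Set (Fin d → ℝ)) := by
  ext x
  simp only [Set.mem_range, coe_image, Set.mem_image, coe_range, Set.mem_Iio]
  constructor
  · rintro ⟨j, rfl⟩; exact ⟨j, j.2, rfl⟩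
  · rintro ⟨j, hj, rfl⟩; exact ⟨⟨j, hj⟩, rfl⟩

/-- the face with index set `S`. -/
def GF (d n s : ℕ) (S : Finset ℕ) : Set (Fin d → ℝ) := convexHull ℝ (pt d n s '' (S : Set ℕ))

lemma Facial.face {d n s : ℕ} (hd : 1 ≤ d) {S : Finset ℕ} (h : Facial d n s S) :
    IsFaceOf (acPolytope d n s) (GF d n s S) ∧ ∀ j < n, pt d n s j ∈ GF d n s S ↔ j ∈ S := by
  obtain ⟨hSn, σ, hσ0, f, hfd, hf⟩ := h
  obtain ⟨b, hb, hb0⟩ := vec_poly hd n s f hfd (-σ)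
  have hle : ∀ v ∈ (range n).image (pt d n s), b ⬝ᵥ v ≤ - f.coeff 0 := by
    intro v hv
    obtain ⟨j, hj, rfl⟩ := Finset.mem_image.1 hv
    rw [hb]
    linarith [(hf j (mem_range.1 hj)).1]
  have hiff : ∀ j < n, b ⬝ᵥ pt d n s j = - f.coeff 0 ↔ j ∈ S := by
    intro j hj
    rw [hb, ← (hf j hj).2]
    constructor <;> intro h <;> linarith
  have hG : {x ∈ acPolytope d n s | b ⬝ᵥ x = - f.coeff 0} = GF d n s S := by
    unfold acPolytope
    rw [range_acPoint, face_hull _ hle]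
    unfold GF
    congr 1
    ext x
    simp only [coe_filter, mem_image, mem_range, Set.mem_ofPred_eq, Set.mem_image, mem_coe]
    constructor
    · rintro ⟨⟨j, hj, rfl⟩, h2⟩
      exact ⟨j, (hiff j hj).1 h2, rfl⟩
    · rintro ⟨j, hj, rfl⟩
      have := mem_range.1 (hSn hj)
      exact ⟨⟨j, this, rfl⟩, (hiff j this).2 hj⟩
  refine ⟨Or.inr (Or.inr ⟨b, - f.coeff 0, fun h => hσ0 (by simpa using hb0 h), ?_, hG.symm⟩), ?_⟩
  · intro x hx
    unfold acPolytope at hx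
    rw [range_acPoint] at hx
    exact dot_conv_le hle hx
  · intro j hj
    rw [← hiff j hj, ← hG]
    constructor
    · exact fun h => h.2
    · intro h
      refine ⟨subset_convexHull ℝ _ ⟨⟨j, hj⟩, rfl⟩, h⟩

lemma finrank_pts {d n s : ℕ} (hd : 1 ≤ d) {S : Finset ℕ} {k : ℕ} (hc : S.card = k + 1)
    (hSd : S.card ≤ d) :
    Module.finrank ℝ (vectorSpan ℝ (pt d n s '' (S : Set ℕ))) = k := by
  classical
  have hai : AffineIndependent ℝ (fun j : S => pt d n s j) := by
    rw [affineIndependent_iff]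
    intro A w hw0 hwp e he
    set v : ℕ → ℝ := fun j => acT d s j with hv
    have hvinj : Set.InjOn v (S : Set ℕ) := by
      intro a _ b _ hab
      have : (a : ℝ) = b := by simp only [hv, acT_eq] at hab; linarith
      exact_mod_cast this
    obtain ⟨b, hb, _⟩ := vec_poly hd n s
      (Lagrange.interpolate S v (fun j => if j = (e : ℕ) then (1 : ℝ) else 0))
      ((Lagrange.degree_interpolate_lt _ hvinj).trans_le (by exact_mod_cast hSd)) 0
    have h1 := congrArg (fun x => b ⬝ᵥ x) hwp
    simp only [dotProduct_sum, dotProduct_smul, hb, smul_eq_mul, dotProduct_zero, zero_mul,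
      zero_add, mul_sub, Finset.sum_sub_distrib, ← Finset.sum_mul, hw0, sub_zero] at h1
    rw [← h1]
    rw [Finset.sum_eq_single e]
    · have := Lagrange.eval_interpolate_at_node (fun j => if j = (e : ℕ) then (1 : ℝ) else 0)
        hvinj e.2
      simp only [hv] at this
      rw [this]; simp
    · intro j _ hje
      have := Lagrange.eval_interpolate_at_node (fun j => if j = (e : ℕ) then (1 : ℝ) else 0)
        hvinj j.2
      simp only [hv] at this
      rw [this, if_neg (fun h => hje (Subtype.ext h)), mul_zero]
    · exact fun h => absurd he h
  have := hai.finrank_vectorSpan (n := k) (by simpa using hc)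
  have hr : pt d n s '' (S : Set ℕ) = Set.range (fun j : S => pt d n s j) :=
    Set.image_eq_range _ _
  rw [hr]; exact this

lemma faces_finite {d : ℕ} (V : Finset (Fin d → ℝ)) :
    {G | IsFaceOf (convexHull ℝ (V : Set (Fin d → ℝ))) G}.Finite := by
  refine Set.Finite.subset (s := {∅, convexHull ℝ (V : Set (Fin d → ℝ))} ∪
    (fun S : Finset (Fin d → ℝ) => convexHull ℝ (S : Set (Fin d → ℝ))) '' V.powerset)
    ((Set.toFinite _).union ((Finset.finite_toSet _).image _)) ?_
  rintro G (h | h | ⟨b, c, _, hb, hG⟩)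
  · left; left; exact h
  · left; right; exact h
  · right
    refine ⟨{v ∈ V | b ⬝ᵥ v = c}, by
      rw [Finset.mem_coe, Finset.mem_powerset]; exact Finset.filter_subset _ _, ?_⟩
    simp only
    rw [← face_hull V (fun v hv => hb v (subset_convexHull ℝ _ hv))]
    exact hG.symm

theorem cside {d n s : ℕ} (hd : 2 ≤ d) (hn : d + s < n) (i : ℕ) (hi1 : 1 ≤ i) (hid : i ≤ d)
    (fam : Finset (Finset ℕ)) (hfam : ∀ S ∈ fam, S.card = i ∧ ∃ T, S ⊆ T ∧ T ⊆ range n ∧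
      T.card = d ∧ (∃ t ∈ T, d + s ≤ t) ∧ ∃ e : ℕ, ∀ w < n, w ∉ T →
      #{t ∈ T | w < t} % 2 = e % 2) :
    fam.card + (if i = d then 1 else 0) ≤ fVec (acPolytope d n s) (i - 1) := by
  have hfac : ∀ S ∈ fam, Facial d n s S := by
    intro S hS
    obtain ⟨_, T, h1, h2, h3, h4, e, h5⟩ := hfam S hS
    exact facial_of (by omega) (by omega) h1 h2 h3 h4 e h5
  have hinj : ∀ S S', Facial d n s S → Facial d n s S' → GF d n s S = GF d n s S' → S = S' := by
    intro S S' h h' he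
    ext j
    by_cases hj : j < n
    · rw [← (h.face (by omega)).2 j hj, he, (h'.face (by omega)).2 j hj]
    · have h1 : j ∉ S := fun hh => hj (mem_range.1 (h.1 hh))
      have h2 : j ∉ S' := fun hh => hj (mem_range.1 (h'.1 hh))
      simp [h1, h2]
  have hfin : {G : Set (Fin d → ℝ) | IsFaceOf (acPolytope d n s) G ∧ G.Nonempty ∧
      polyDim G = i - 1}.Finite := by
    refine Set.Finite.subset (faces_finite ((range n).image (pt d n s))) ?_
    rintro G ⟨h, _⟩
    unfold acPolytope at h
    rw [range_acPoint] at h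
    exact h
  have hmem : ∀ S ∈ fam, GF d n s S ∈ {G : Set (Fin d → ℝ) | IsFaceOf (acPolytope d n s) G ∧
      G.Nonempty ∧ polyDim G = i - 1} := by
    intro S hS
    have hc := (hfam S hS).1
    refine ⟨((hfac S hS).face (by omega)).1, ?_, ?_⟩
    · have : S.Nonempty := Finset.card_pos.1 (by omega)
      unfold GF
      rw [convexHull_nonempty_iff]
      exact Set.Nonempty.image _ (by exact_mod_cast this)
    · unfold GF
      rw [polyDim_conv, finrank_pts (k := i - 1) (by omega) (by omega) (by omega)]
  have himg : ((GF d n s) '' (fam : Set (Finset ℕ))).ncard = fam.card := by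
    rw [Set.InjOn.ncard_image, Set.ncard_coe_finset]
    intro S hS S' hS' he
    exact hinj S S' (hfac S hS) (hfac S' hS') he
  unfold fVec
  split_ifs with hi
  · have hF := facial_F hn (by omega : 2 ≤ n)
    have hnot : GF d n s (range (d + s)) ∉ (GF d n s) '' (fam : Set (Finset ℕ)) := by
      rintro ⟨S, hS, he⟩
      have := hinj S _ (hfac S hS) hF he
      obtain ⟨hc, T, h1, _, h3, ⟨t, ht, h4⟩, _⟩ := hfam S hS
      have hST : S = T := Finset.eq_of_subset_of_card_le h1 (by omega)
      rw [← hST, this, mem_range] at ht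
      omega
    rw [← himg, ← Set.ncard_insert_of_notMem hnot ((Finset.finite_toSet _).image _)]
    refine Set.ncard_le_ncard ?_ hfin
    rintro G (rfl | ⟨S, hS, rfl⟩)
    · refine ⟨(hF.face (by omega)).1, ?_, ?_⟩
      · unfold GF
        rw [convexHull_nonempty_iff]
        exact ⟨_, 0, by simp; omega, rfl⟩
      · unfold GF
        rw [polyDim_conv]
        apply le_antisymm
        · obtain ⟨b, hb, hb0⟩ := vec_poly (d := d) (by omega) n s 0
            (by rw [degree_zero]; exact WithBot.bot_lt_coe _) 1
          have hbne : b ≠ 0 := fun h => one_ne_zero (hb0 h)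
          have hlt : vectorSpan ℝ (pt d n s '' (range (d + s) : Set ℕ)) < ⊤ := by
            rw [lt_top_iff_ne_top]
            intro htop
            rw [vectorSpan_def] at htop
            refine hbne (eq_zero_of_span htop ?_)
            rintro _ ⟨_, ⟨j, hj, rfl⟩, _, ⟨k, hk, rfl⟩, rfl⟩
            simp only [coe_range, Set.mem_Iio] at hj hk
            simp only [vsub_eq_sub]
            rw [dotProduct_sub, hb, hb, pv_zero hj, pv_zero hk]
            simp
          have := Submodule.finrank_lt_finrank_of_lt hlt
          rw [finrank_top, Module.finrank_fintype_fun_eq_card, Fintype.card_fin] at this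
          omega
        · rw [← finrank_pts (d := d) (n := n) (s := s) (S := range d) (k := i - 1) (by omega)
            (by simp; omega) (by simp)]
          refine Submodule.finrank_mono (vectorSpan_mono ℝ (Set.image_mono ?_))
          intro j hj
          simp only [coe_range, Set.mem_Iio] at hj ⊢
          omega
    · exact hmem S hS
  · rw [add_zero, ← himg]
    refine Set.ncard_le_ncard ?_ hfin
    rintro G ⟨S, hS, rfl⟩
    exact hmem S hS

end cfaces


section ccount

open Polynomial

/-- patterns on the last `g + r` positions. -/
def XX (n q : ℕ) : ℕ → ℕ → Finset (Finset ℕ)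
  | 0, r => (Finset.Ico (n - r) n).powerset
  | g + 1, 0 => if g + 1 = q then ∅ else XX n q g 0
  | g + 1, 1 => XX n q g 1
  | g + 1, r + 2 => XX n q g (r + 2) ∪
      ((XX n q (g + 1) r).image (insert (n - (g + r + 3))) ∪
       (XX n q (g + 1) r).image (fun S => insert (n - (g + r + 3)) (insert (n - (g + r + 2)) S)))
  termination_by g r => (g, r)

/-- what a pattern guarantees. -/
def Good (n q g r : ℕ) (S T : Finset ℕ) : Prop :=
  S ⊆ T ∧ T ⊆ Finset.Ico (n - (g + r)) n ∧ T.card = r ∧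
    (∀ w ∈ Finset.Ico (n - (g + r)) n, w ∉ T → #{t ∈ T | w < t} % 2 = r % 2) ∧
    (q ≤ g → ∃ t ∈ T, n - q ≤ t)

lemma pigeon {n q r : ℕ} {T : Finset ℕ} (h : q + r ≤ n + 1) (hT : T ⊆ Finset.Ico (n - (q + r)) n)
    (hc : T.card = r + 1) : ∃ t ∈ T, n - q ≤ t := by
  by_contra hcon
  push Not at hcon
  have : T ⊆ Finset.Ico (n - (q + r)) (n - q) := fun t ht =>
    Finset.mem_Ico.2 ⟨(Finset.mem_Ico.1 (hT ht)).1, hcon t ht⟩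
  have := Finset.card_le_card this
  rw [Nat.card_Ico] at this
  omega

lemma good_gap {n q g r : ℕ} {S T : Finset ℕ} (hgr : g + 1 + r ≤ n) (h : Good n q g r S T)
    (hq : q ≤ g + 1 → ∃ t ∈ T, n - q ≤ t) : Good n q (g + 1) r S T := by
  obtain ⟨h1, h2, h3, h4, h5⟩ := h
  refine ⟨h1, h2.trans (Finset.Ico_subset_Ico (by omega) le_rfl), h3, ?_, hq⟩
  intro w hw hwT
  rw [Finset.mem_Ico] at hw
  rcases eq_or_lt_of_le hw.1 with h | h
  · have : ({t ∈ T | w < t} : Finset ℕ) = T := by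
      refine Finset.filter_true_of_mem fun t ht => ?_
      have := Finset.mem_Ico.1 (h2 ht)
      omega
    rw [this, h3]
  · exact h4 w (Finset.mem_Ico.2 ⟨by omega, hw.2⟩) hwT

lemma filter_insert_small {o w : ℕ} {T : Finset ℕ} (h : o ≤ w) :
    ({t ∈ insert o T | w < t} : Finset ℕ) = {t ∈ T | w < t} := by
  rw [Finset.filter_insert, if_neg (by omega)]

lemma good_pair {n q g r : ℕ} {S T : Finset ℕ} (hgr : g + r + 3 ≤ n)
    (h : Good n q (g + 1) r S T) :
    Good n q (g + 1) (r + 2) (insert (n - (g + r + 3)) (insert (n - (g + r + 2)) S))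
      (insert (n - (g + r + 3)) (insert (n - (g + r + 2)) T)) := by
  obtain ⟨h1, h2, h3, h4, h5⟩ := h
  have hlt : ∀ t ∈ T, n - (g + r + 2) < t := fun t ht => by
    have := Finset.mem_Ico.1 (h2 ht); omega
  refine ⟨Finset.insert_subset_insert _ (Finset.insert_subset_insert _ h1), ?_, ?_, ?_, ?_⟩
  · intro t ht
    rw [Finset.mem_insert, Finset.mem_insert] at ht
    rw [Finset.mem_Ico]
    rcases ht with rfl | rfl | ht
    · omega
    · omega
    · have := Finset.mem_Ico.1 (h2 ht); omega
  · rw [Finset.card_insert_of_notMem, Finset.card_insert_of_notMem, h3]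
    · intro h; have := hlt _ h; omega
    · intro h
      rw [Finset.mem_insert] at h
      rcases h with h | h
      · omega
      · have := hlt _ h; omega
  · intro w hw hwT
    rw [Finset.mem_insert, Finset.mem_insert] at hwT
    push Not at hwT
    rw [Finset.mem_Ico] at hw
    rw [filter_insert_small (by omega), filter_insert_small (by omega),
      h4 w (Finset.mem_Ico.2 ⟨by omega, hw.2⟩) hwT.2.2]
    omega
  · intro hq
    obtain ⟨t, ht, h⟩ := h5 hq
    exact ⟨t, by simp [ht], h⟩

lemma good_mono {n q g r : ℕ} {S S' T : Finset ℕ} (h : Good n q g r S T) (hS : S' ⊆ S) :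
    Good n q g r S' T := ⟨hS.trans h.1, h.2⟩

lemma XX_good (n q : ℕ) (hq : 1 ≤ q) (g r : ℕ) : g + r ≤ n → ∀ S ∈ XX n q g r,
    ∃ T, Good n q g r S T := by
  fun_induction XX n q g r with
  | case1 r =>
    intro h S hS
    rw [Finset.mem_powerset] at hS
    refine ⟨Finset.Ico (n - r) n, hS, by simp, by simp; omega, ?_, by omega⟩
    intro w hw hwT
    simp only [zero_add] at hw
    exact absurd hw hwT
  | case2 => intro h S hS; simp at hS
  | case3 g hgq ih =>
    intro h S hS
    obtain ⟨T, hT⟩ := ih (by omega) S hS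
    exact ⟨T, good_gap (by omega) hT fun h => hT.2.2.2.2 (by omega)⟩
  | case4 g ih =>
    intro h S hS
    obtain ⟨T, hT⟩ := ih (by omega) S hS
    refine ⟨T, good_gap (by omega) hT fun h => ?_⟩
    rcases Nat.lt_or_ge g q with h' | h'
    · have : q = g + 1 := by omega
      exact pigeon (r := 0) (by omega) (hT.2.1.trans (Finset.Ico_subset_Ico (by omega) le_rfl))
        hT.2.2.1
    · exact hT.2.2.2.2 h'
  | case5 g r ih1 ih2 =>
    intro h S hS
    rw [Finset.mem_union, Finset.mem_union, Finset.mem_image, Finset.mem_image] at hS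
    rcases hS with hS | ⟨S, hS, rfl⟩ | ⟨S, hS, rfl⟩
    · obtain ⟨T, hT⟩ := ih1 (by omega) S hS
      refine ⟨T, good_gap (by omega) hT fun h => ?_⟩
      rcases Nat.lt_or_ge g q with h' | h'
      · have : q = g + 1 := by omega
        exact pigeon (r := r + 1) (by omega)
          (hT.2.1.trans (Finset.Ico_subset_Ico (by omega) le_rfl)) hT.2.2.1
      · exact hT.2.2.2.2 h'
    · obtain ⟨T, hT⟩ := ih2 (by omega) S hS
      exact ⟨_, good_mono (good_pair (by omega) hT)
        (Finset.insert_subset_insert _ (Finset.subset_insert _ _))⟩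
    · obtain ⟨T, hT⟩ := ih2 (by omega) S hS
      exact ⟨_, good_pair (by omega) hT⟩

/-- weight enumerator -/
def wt (F : Finset (Finset ℕ)) : ℤ[X] := ∑ S ∈ F, (X : ℤ[X]) ^ #S

lemma wt_union {F G : Finset (Finset ℕ)} (h : Disjoint F G) : wt (F ∪ G) = wt F + wt G :=
  Finset.sum_union h

lemma wt_image {F : Finset (Finset ℕ)} (o : ℕ) (h : ∀ S ∈ F, o ∉ S) :
    wt (F.image (insert o)) = X * wt F := by
  unfold wt
  rw [Finset.sum_image, Finset.mul_sum]
  · refine Finset.sum_congr rfl fun S hS => ?_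
    rw [Finset.card_insert_of_notMem (h S hS), pow_succ']
  · intro S hS S' hS' he
    rw [← Finset.erase_insert (h S hS), he, Finset.erase_insert (h S' hS')]

lemma wt_powerset (A : Finset ℕ) : wt A.powerset = (1 + X) ^ #A := by
  unfold wt
  rw [add_comm, ← Finset.sum_pow_mul_eq_add_pow]
  simp

lemma XX_wt (n q : ℕ) (hq : 1 ≤ q) (g r : ℕ) (h : g + 1 + (r + 2) ≤ n) :
    wt (XX n q (g + 1) (r + 2)) = wt (XX n q g (r + 2)) + (X + X ^ 2) * wt (XX n q (g + 1) r) := by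
  have h1 : ∀ S ∈ XX n q g (r + 2), n - (g + r + 3) ∉ S := by
    intro S hS hc
    obtain ⟨T, hT⟩ := XX_good n q hq g (r + 2) (by omega) S hS
    have := Finset.mem_Ico.1 (hT.2.1 (hT.1 hc))
    omega
  have h2 : ∀ S ∈ XX n q (g + 1) r, ∀ t ∈ S, n - (g + r + 2) < t := by
    intro S hS t hc
    obtain ⟨T, hT⟩ := XX_good n q hq (g + 1) r (by omega) S hS
    have := Finset.mem_Ico.1 (hT.2.1 (hT.1 hc))
    omega
  have e : (XX n q (g + 1) r).image
      (fun S => insert (n - (g + r + 3)) (insert (n - (g + r + 2)) S)) =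
      ((XX n q (g + 1) r).image (insert (n - (g + r + 2)))).image (insert (n - (g + r + 3))) := by
    rw [Finset.image_image]; rfl
  have h3 : ∀ S ∈ (XX n q (g + 1) r).image (insert (n - (g + r + 2))), n - (g + r + 3) ∉ S := by
    intro S hS hc
    obtain ⟨S1, hS1, rfl⟩ := Finset.mem_image.1 hS
    rw [Finset.mem_insert] at hc
    rcases hc with hc | hc
    · omega
    · have := h2 S1 hS1 _ hc; omega
  rw [XX, wt_union, wt_union, e, wt_image _ h3, wt_image, wt_image]
  · ring
  · intro S hS hc; have := h2 S hS _ hc; omega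
  · intro S hS hc; have := h2 S hS _ hc; omega
  · rw [Finset.disjoint_left]
    intro S hS hS'
    obtain ⟨S1, hS1, rfl⟩ := Finset.mem_image.1 hS
    obtain ⟨S2, hS2, he⟩ := Finset.mem_image.1 hS'
    have : n - (g + r + 2) ∈ insert (n - (g + r + 3)) S1 := by rw [← he]; simp
    rw [Finset.mem_insert] at this
    rcases this with hc | hc
    · omega
    · have := h2 S1 hS1 _ hc; omega
  · rw [Finset.disjoint_left]
    intro S hS hS'
    refine h1 S hS ?_
    rw [Finset.mem_union, Finset.mem_image, Finset.mem_image] at hS'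
    rcases hS' with ⟨S, _, rfl⟩ | ⟨S, _, rfl⟩ <;> simp

/-- coefficients -/
def MM (q g r j : ℕ) : ℤ :=
  if 2 * j < r then (g.multichoose j : ℤ)
  else if 2 * j = r then (g.multichoose j : ℤ) -
    (if q ≤ g then ((g - q + 1).multichoose j : ℤ) else 0)
  else 0

lemma XX_eq (n q : ℕ) (hq : 1 ≤ q) (g r : ℕ) : g + r ≤ n →
    wt (XX n q g r) = ∑ j ∈ range (r + 1), C (MM q g r j) * X ^ j * (1 + X) ^ (r - j) := by
  fun_induction XX n q g r with
  | case1 r =>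
    intro h
    rw [wt_powerset, Finset.sum_eq_single 0]
    · have : MM q 0 r 0 = 1 := by
        unfold MM
        rcases Nat.eq_zero_or_pos r with rfl | hr
        · simp; omega
        · simp [hr]
      rw [this]
      simp only [Nat.card_Ico, map_one, pow_zero, mul_one, one_mul, tsub_zero]
      congr 1; omega
    · intro j _ hj
      have : MM q 0 r j = 0 := by
        unfold MM
        obtain ⟨k, rfl⟩ : ∃ k, j = k + 1 := ⟨j - 1, by omega⟩
        simp; omega
      rw [this]; simp
    · intro h; simp at h
  | case2 g hg =>
    intro h
    simp [wt, MM, hg]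
  | case3 g hg ih =>
    intro h
    rw [ih (by omega)]
    simp only [zero_add, Finset.sum_range_one]
    congr 3
    unfold MM
    simp
    congr 1
    simp; omega
  | case4 g ih =>
    intro h
    rw [ih (by omega)]
    simp [MM]
  | case5 g r ih1 ih2 =>
    intro h
    have hx := XX_wt n q hq g r (by omega)
    rw [XX] at hx
    rw [hx, ih1 (by omega), ih2 (by omega)]
    have e0 : MM q (g + 1) (r + 2) 0 = MM q g (r + 2) 0 := by unfold MM; simp
    have e1 : ∀ j, MM q (g + 1) (r + 2) (j + 1) = MM q g (r + 2) (j + 1) + MM q (g + 1) r j := by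
      intro j
      unfold MM
      have a1 : (2 * (j + 1) < r + 2) = (2 * j < r) := by apply propext; omega
      have a2 : (2 * (j + 1) = r + 2) = (2 * j = r) := by apply propext; omega
      simp only [a1, a2, Nat.multichoose_succ_succ]
      by_cases b1 : 2 * j < r
      · simp only [if_pos b1]; push_cast; ring
      by_cases b2 : 2 * j = r
      · simp only [if_neg b1, if_pos b2]
        rcases lt_trichotomy q (g + 1) with b | b | b
        · have e2 : g + 1 - q = g - q + 1 := by omega
          rw [if_pos (by omega), if_pos (by omega), if_pos (by omega), e2,
            Nat.multichoose_succ_succ (g - q) j]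
          push_cast; ring
        · have e2 : g + 1 - q = 0 := by omega
          rw [if_pos (by omega), if_neg (by omega), if_pos (by omega), e2]
          simp
          ring
        · rw [if_neg (by omega), if_neg (by omega), if_neg (by omega)]
          push_cast; ring
      · simp only [if_neg b1, if_neg b2, add_zero]
    rw [Finset.sum_range_succ', Finset.sum_range_succ' _ (r + 2), e0]
    simp only [e1]
    rw [Finset.sum_range_succ _ (r + 1), Finset.sum_range_succ _ (r + 1)]
    have a3 : MM q (g + 1) r (r + 1) = 0 := by
      unfold MM; rw [if_neg (by omega), if_neg (by omega)]
    rw [a3, Finset.mul_sum]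
    have : ∀ j ∈ range (r + 1), C (MM q g (r + 2) (j + 1) + MM q (g + 1) r j) * X ^ (j + 1) *
        (1 + X) ^ (r + 2 - (j + 1)) = C (MM q g (r + 2) (j + 1)) * X ^ (j + 1) *
        (1 + X) ^ (r + 2 - (j + 1)) + (X + X ^ 2) * (C (MM q (g + 1) r j) * X ^ j *
        (1 + X) ^ (r - j)) := by
      intro j hj
      rw [Finset.mem_range] at hj
      have : r + 2 - (j + 1) = r - j + 1 := by omega
      rw [this, map_add]; ring
    rw [Finset.sum_congr rfl this, Finset.sum_add_distrib, add_zero]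
    ring

/-- the whole family -/
def VV (n d q : ℕ) : ℕ → Finset (Finset ℕ)
  | 0 => ∅
  | r + 1 => XX n q (n - d - 1) (r + 1) ∪ (VV n d q r).image (insert (d - r - 1))

lemma VV_good (n d s q : ℕ) (hq : 1 ≤ q) (hn : n = d + s + q) (r : ℕ) (hr : r ≤ d) :
    ∀ S ∈ VV n d q r, ∃ T, S ⊆ T ∧ T ⊆ Finset.Ico (d - r) n ∧ T.card = r ∧
      (∃ e, ∀ w ∈ Finset.Ico (d - r) n, w ∉ T → #{t ∈ T | w < t} % 2 = e % 2) ∧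
      ∃ t ∈ T, n - q ≤ t := by
  induction r with
  | zero => intro S hS; simp [VV] at hS
  | succ r ih =>
    intro S hS
    rw [VV, Finset.mem_union, Finset.mem_image] at hS
    rcases hS with hS | ⟨S, hS, rfl⟩
    · obtain ⟨T, hT⟩ := XX_good n q hq _ _ (by omega) S hS
      have h5 : ∃ t ∈ T, n - q ≤ t := by
        rcases Nat.eq_zero_or_pos s with h | h
        · exact pigeon (r := r) (by omega)
            (hT.2.1.trans (Finset.Ico_subset_Ico (by omega) le_rfl)) hT.2.2.1
        · exact hT.2.2.2.2 (by omega)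
      obtain ⟨h1, h2, h3, h4, h6⟩ := good_gap (by omega) hT fun _ => h5
      have e : n - (n - d - 1 + 1 + (r + 1)) = d - (r + 1) := by omega
      rw [e] at h2 h4
      exact ⟨T, h1, h2, h3, ⟨_, h4⟩, h5⟩
    · obtain ⟨T, h1, h2, h3, ⟨e, h4⟩, t, ht, h5⟩ := ih (by omega) S hS
      refine ⟨insert (d - r - 1) T, Finset.insert_subset_insert _ h1, ?_, ?_, ⟨e, ?_⟩, t, ?_, h5⟩
      · intro t ht
        rw [Finset.mem_insert] at ht
        rw [Finset.mem_Ico]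
        rcases ht with rfl | ht
        · omega
        · have := Finset.mem_Ico.1 (h2 ht); omega
      · rw [Finset.card_insert_of_notMem, h3]
        intro h; have := Finset.mem_Ico.1 (h2 h); omega
      · intro w hw hwT
        rw [Finset.mem_insert] at hwT
        push Not at hwT
        rw [Finset.mem_Ico] at hw
        rw [filter_insert_small (by omega), h4 w (Finset.mem_Ico.2 ⟨by omega, hw.2⟩) hwT.2]
      · exact Finset.mem_insert_of_mem ht

/-- integer version of `Bc` -/
def BZ (d s q k : ℕ) : ℤ :=
  if 2 * k < d then ((s + q).multichoose k : ℤ)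
  else if k ≤ d then ((s + q).multichoose (d - k) : ℤ) - (s.multichoose (d - k) : ℤ) else 0

lemma mc_mono (s q k : ℕ) : s.multichoose k ≤ (s + q).multichoose k := by
  induction q with
  | zero => simp
  | succ q ih =>
    refine ih.trans ?_
    cases k with
    | zero => simp
    | succ k => rw [← add_assoc, Nat.multichoose_succ_succ]; omega

lemma BZ_eq {d s q k : ℕ} (h : k ≤ d) : BZ d s q k = (Bc d s q k : ℤ) := by
  unfold BZ Bc
  rw [if_pos h]
  split_ifs
  · rfl
  · rw [Nat.cast_sub (mc_mono _ _ _)]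

lemma BZ_zero (s q r : ℕ) (hq : 1 ≤ q) : BZ (r + 1) s q 0 = MM q (s + q - 1) (r + 1) 0 := by
  unfold BZ MM; simp

lemma BZ_succ (s q r k : ℕ) (hq : 1 ≤ q) :
    BZ (r + 1) s q (k + 1) = MM q (s + q - 1) (r + 1) (k + 1) + BZ r s q k := by
  obtain ⟨N, hN⟩ : ∃ N, s + q = N + 1 := ⟨s + q - 1, by omega⟩
  unfold BZ MM
  rw [hN, Nat.add_sub_cancel]
  rcases lt_trichotomy (2 * (k + 1)) (r + 1) with h | h | h
  · rw [if_pos h, if_pos h, if_pos (by omega), Nat.multichoose_succ_succ]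
    push_cast; ring
  · have h1 : ¬ 2 * (k + 1) < r + 1 := by omega
    have h2 : k + 1 ≤ r + 1 := by omega
    have h3 : 2 * k < r := by omega
    simp only [if_neg h1, if_pos h2, if_pos h, if_pos h3]
    have e1 : r + 1 - (k + 1) = k + 1 := by omega
    rw [e1, Nat.multichoose_succ_succ]
    split_ifs with hc
    · have e2 : N - q + 1 = s := by omega
      rw [e2]; push_cast; ring
    · have : s = 0 := by omega
      subst this
      simp
  · have h1 : ¬ 2 * (k + 1) < r + 1 := by omega
    have h2 : ¬ 2 * (k + 1) = r + 1 := by omega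
    have h3 : ¬ 2 * k < r := by omega
    simp only [if_neg h1, if_neg h2, if_neg h3]
    have e1 : r + 1 - (k + 1) = r - k := by omega
    have e2 : (k + 1 ≤ r + 1) = (k ≤ r) := by apply propext; omega
    rw [e1, zero_add]
    simp only [e2]

lemma VV_eq (n d s q : ℕ) (hq : 1 ≤ q) (hn : n = d + s + q) (r : ℕ) (hr : r ≤ d) :
    wt (VV n d q r) = ∑ k ∈ range (r + 1), C (BZ r s q k) * X ^ k * (1 + X) ^ (r - k) := by
  induction r with
  | zero => simp [VV, wt, BZ]
  | succ r ih =>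
    have hN : n - d - 1 = s + q - 1 := by omega
    rw [VV, wt_union, wt_image, ih (by omega), XX_eq n q hq _ _ (by omega), hN,
      Finset.sum_range_succ', Finset.sum_range_succ' _ (r + 1)]
    · rw [BZ_zero _ _ _ hq, Finset.mul_sum]
      simp only [BZ_succ _ _ _ _ hq, map_add, add_mul, Finset.sum_add_distrib]
      have : ∀ k ∈ range (r + 1), C (BZ r s q k) * X ^ (k + 1) * (1 + X) ^ (r + 1 - (k + 1)) =
          X * (C (BZ r s q k) * X ^ k * (1 + X) ^ (r - k)) := by
        intro k _
        have : r + 1 - (k + 1) = r - k := by omega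
        rw [this]; ring
      rw [Finset.sum_congr rfl this]
      ring
    · intro S hS hc
      obtain ⟨T, h1, h2, _⟩ := VV_good n d s q hq hn r (by omega) S hS
      have := Finset.mem_Ico.1 (h2 (h1 hc))
      omega
    · rw [Finset.disjoint_left]
      intro S hS hS'
      obtain ⟨S', _, rfl⟩ := Finset.mem_image.1 hS'
      obtain ⟨T, hT⟩ := XX_good n q hq (n - d - 1) (r + 1) (by omega) _ hS
      have h3 := (Finset.mem_Ico.1 (hT.2.1 (hT.1 (Finset.mem_insert_self _ _)))).1
      clear hT
      omega

theorem fam_exists {d n s : ℕ} (hn : d + s < n) (i : ℕ) (hid : i ≤ d) :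
    ∃ fam : Finset (Finset ℕ), (∀ S ∈ fam, S.card = i ∧ ∃ T, S ⊆ T ∧ T ⊆ range n ∧
      T.card = d ∧ (∃ t ∈ T, d + s ≤ t) ∧ ∃ e : ℕ, ∀ w < n, w ∉ T →
      #{t ∈ T | w < t} % 2 = e % 2) ∧
      fam.card = ∑ k ∈ range (i + 1), (d - k).choose (i - k) * Bc d s (n - d - s) k := by
  have hn' : n = d + s + (n - d - s) := by omega
  set q := n - d - s with hq
  have hq1 : 1 ≤ q := by omega
  refine ⟨{S ∈ VV n d q d | #S = i}, ?_, ?_⟩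
  · intro S hS
    rw [Finset.mem_filter] at hS
    obtain ⟨T, h1, h2, h3, ⟨e, h4⟩, t, ht, h5⟩ := VV_good n d s q hq1 hn' d le_rfl S hS.1
    rw [Nat.sub_self] at h2 h4
    refine ⟨hS.2, T, h1, fun x hx => mem_range.2 (Finset.mem_Ico.1 (h2 hx)).2, h3,
      ⟨t, ht, by omega⟩, e, fun w hw => h4 w (by simp [hw])⟩
  · have h := congrArg (fun p => p.coeff i) (VV_eq n d s q hq1 hn' d le_rfl)
    simp only [wt, finsetSum_coeff, coeff_X_pow, mul_assoc, coeff_C_mul, coeff_X_pow_mul',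
      coeff_one_add_X_pow] at h
    have h1 : ((#{S ∈ VV n d q d | #S = i} : ℕ) : ℤ) = ∑ S ∈ VV n d q d, if i = #S then 1 else 0 := by
      rw [Finset.card_filter]; push_cast
      exact Finset.sum_congr rfl fun S _ => by simp only [eq_comm]
    have h2 : ∑ k ∈ range (d + 1), BZ d s q k *
        (if k ≤ i then (((d - k).choose (i - k) : ℕ) : ℤ) else 0) =
        ∑ k ∈ range (i + 1), (((d - k).choose (i - k) * Bc d s q k : ℕ) : ℤ) := by
      rw [← Finset.sum_subset (Finset.range_subset_range.2 (by omega : i + 1 ≤ d + 1))]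
      · refine Finset.sum_congr rfl fun k hk => ?_
        rw [mem_range] at hk
        rw [if_pos (by omega), BZ_eq (by omega)]; push_cast; ring
      · intro k _ hk
        rw [mem_range] at hk
        rw [if_neg (by omega), mul_zero]
    have h3 := (h1.trans h).trans h2
    exact_mod_cast h3

end ccount

/-- **Upper Bound Theorem for almost simplicial polytopes, f-vector form.**
For `d ≥ 2`, `s ≥ 0`, `n > d+s` and `P ∈ 𝒫(d,n,s)`:
`f_{i−1}(P) ≤ f_{i−1}(C(d,n,s))` for every `1 ≤ i ≤ d`, where `C(d,n,s)` is the almost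
cyclic polytope. -/
theorem ubt_asp (d n s : ℕ) (hd : 2 ≤ d) (hn : d + s < n)
    (P : Set (Fin d → ℝ)) (hP : MemASP d n s P) :
    ∀ i : ℕ, 1 ≤ i → i ≤ d → fVec P (i - 1) ≤ fVec (acPolytope d n s) (i - 1) := by
  intro i h1 h2
  obtain ⟨fam, hfam, hc⟩ := fam_exists hn i h2
  have hp := pside hd hn hP i h1 h2
  rw [← hc] at hp
  exact hp.trans (cside hd hn i h1 h2 fam hfam)

end

end ASP
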